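/- Let A be a computably enumerable set which is not K-trivial. Then there exists a computably enumerable set B such that B is Turing equivalent to the halting problem ∅′ and B <_K A. -/

import Mathlib

open Part Filter

open scoped Classical

namespace KPaper

/-- Binary strings. -/
abbrev Str := List Bool

/-! ### Oracle (Turing) reducibility -/

/-- The functions `ℕ →. ℕ` that are partial recursive relative to an oracle `O : ℕ →. ℕ`.
This mirrors Mathlib's `Nat.Partrec`, with an extra base case for the oracle. -/
inductive RecursiveIn (O : ℕ →. ℕ) : (ℕ →. ℕ) → Prop
  | oracle : RecursiveIn O O
  | zero : RecursiveIn O (pure 0)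
  | succ : RecursiveIn O ↑Nat.succ
  | left : RecursiveIn O ↑fun n : ℕ => n.unpair.1
  | right : RecursiveIn O ↑fun n : ℕ => n.unpair.2
  | pair {f g} : RecursiveIn O f → RecursiveIn O g →
      RecursiveIn O fun n => Nat.pair <$> f n <*> g n
  | comp {f g} : RecursiveIn O f → RecursiveIn O g → RecursiveIn O fun n => g n >>= f
  | prec {f g} : RecursiveIn O f → RecursiveIn O g → RecursiveIn O (Nat.unpaired fun a n =>
      n.rec (f a) fun y IH => do let i ← IH; g (Nat.pair a (Nat.pair y i)))
  | rfind {f} : RecursiveIn O f →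
      RecursiveIn O fun a => Nat.rfind fun n => (fun m => m = 0) <$> f (Nat.pair a n)

/-- The characteristic (partial) function of a set of naturals, used as a Turing oracle. -/
noncomputable def chi (A : Set ℕ) : ℕ →. ℕ := fun n => Part.some (if n ∈ A then 1 else 0)

/-- The characteristic function of an infinite binary sequence, used as a Turing oracle. -/
def chiSeq (X : ℕ → Bool) : ℕ →. ℕ := fun n => Part.some (cond (X n) 1 0)

/-- `A` is Turing reducible to `B`. -/
noncomputable def TuringLeSet (A B : Set ℕ) : Prop := RecursiveIn (chi B) (chi A)

/-- `A` is Turing equivalent to `B`. -/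
noncomputable def TuringEquivSet (A B : Set ℕ) : Prop := TuringLeSet A B ∧ TuringLeSet B A

/-- Turing equivalence between a set and an infinite binary sequence. -/
noncomputable def TuringEquivSetSeq (A : Set ℕ) (X : ℕ → Bool) : Prop :=
  RecursiveIn (chiSeq X) (chi A) ∧ RecursiveIn (chi A) (chiSeq X)

/-- The halting problem `∅'`. -/
def haltingSet : Set ℕ := {n | ((Denumerable.ofNat Nat.Partrec.Code n).eval n).Dom}

/-- A set of naturals is computably enumerable iff it is the domain of a
partial computable function. -/
def CESet (A : Set ℕ) : Prop := ∃ f : ℕ →. ℕ, Nat.Partrec f ∧ ∀ n, n ∈ A ↔ (f n).Dom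

/-! ### Machines and Kolmogorov complexity -/

/-- A (plain) machine is a partial computable map from binary strings to binary strings. -/
def PlainMachine (M : Str →. Str) : Prop := Partrec M

/-- A prefix-free machine: a partial computable map on binary strings whose
domain is an antichain under the prefix relation. -/
def PFMachine (M : Str →. Str) : Prop :=
  Partrec M ∧ ∀ ρ₁ ρ₂ : Str, (M ρ₁).Dom → (M ρ₂).Dom → ρ₁ <+: ρ₂ → ρ₁ = ρ₂

/-- The Kolmogorov complexity of a string `σ` with respect to a machine `M`:
the least length of an `M`-description of `σ` (`⊤` if there is none). -/
noncomputable def KC (M : Str →. Str) (σ : Str) : ℕ∞ :=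
  ⨅ ρ : {ρ : Str // σ ∈ M ρ}, ((ρ : Str).length : ℕ∞)

/-- An optimal prefix-free machine: a prefix-free machine whose associated complexity
is minimal, up to an additive constant, among all prefix-free machines. -/
def OptimalPF (U : Str →. Str) : Prop :=
  PFMachine U ∧ ∀ M : Str →. Str, PFMachine M → ∃ c : ℕ, ∀ σ : Str, KC U σ ≤ KC M σ + c

/-- An optimal plain machine. -/
def OptimalPlain (V : Str →. Str) : Prop :=
  PlainMachine V ∧ ∀ M : Str →. Str, PlainMachine M → ∃ c : ℕ, ∀ σ : Str, KC V σ ≤ KC M σ + c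

/-! ### Initial segments -/

/-- The first `n` bits of the characteristic sequence of a set of naturals. -/
noncomputable def restrSet (A : Set ℕ) (n : ℕ) : Str :=
  (List.range n).map fun i => decide (i ∈ A)

/-- The first `n` bits of an infinite binary sequence. -/
def restrSeq (X : ℕ → Bool) (n : ℕ) : Str := (List.range n).map X

/-- The string `0^n`; `K(n)` is identified with `K(0^n)`. -/
def zeroStr (n : ℕ) : Str := List.replicate n false

/-! ### `≤_K`, `<_K`, `K`-triviality (and the `≤_C` analogues) -/

def KLeSet (U : Str →. Str) (A B : Set ℕ) : Prop :=
  ∃ c : ℕ, ∀ n, KC U (restrSet A n) ≤ KC U (restrSet B n) + c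

def KLtSet (U : Str →. Str) (A B : Set ℕ) : Prop := KLeSet U A B ∧ ¬ KLeSet U B A

def KTrivialSet (U : Str →. Str) (A : Set ℕ) : Prop :=
  ∃ c : ℕ, ∀ n, KC U (restrSet A n) ≤ KC U (zeroStr n) + c

def KLeSeq (U : Str →. Str) (X Y : ℕ → Bool) : Prop :=
  ∃ c : ℕ, ∀ n, KC U (restrSeq X n) ≤ KC U (restrSeq Y n) + c

def KLtSeq (U : Str →. Str) (X Y : ℕ → Bool) : Prop := KLeSeq U X Y ∧ ¬ KLeSeq U Y X

def KTrivialSeq (U : Str →. Str) (X : ℕ → Bool) : Prop :=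
  ∃ c : ℕ, ∀ n, KC U (restrSeq X n) ≤ KC U (zeroStr n) + c

/-! ### Computably enumerable reals -/

/-- The real number in `[0,1]` whose binary expansion is the sequence `X`. -/
noncomputable def realOfSeq (X : ℕ → Bool) : ℝ := ∑' i : ℕ, cond (X i) ((2 : ℝ) ^ (i + 1))⁻¹ 0

/-- `X` (identified with the real it is the binary expansion of) is a computably
enumerable real: it is the limit of a nondecreasing computable sequence of
(dyadic) rationals. -/
def CEReal (X : ℕ → Bool) : Prop :=
  ∃ f : ℕ → ℤ, Computable f ∧
    (∀ s, (f s : ℝ) / 2 ^ s ≤ (f (s + 1) : ℝ) / 2 ^ (s + 1)) ∧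
    Tendsto (fun s => (f s : ℝ) / 2 ^ s) atTop (nhds (realOfSeq X))

/-- The characteristic sequence of a set of naturals. -/
noncomputable def seqOfSet (A : Set ℕ) : ℕ → Bool := fun i => decide (i ∈ A)

/-! ### Solovay reducibility -/

/-- Solovay reducibility on c.e. reals: `X ≤_S Y` iff there are nondecreasing computable
rational approximations to `X` and `Y` and a constant `c` such that at each stage the
distance to `X` is bounded by `c` times the distance to `Y`. -/
def SolovayLe (X Y : ℕ → Bool) : Prop :=
  ∃ (c : ℕ) (f g : ℕ → ℤ), Computable f ∧ Computable g ∧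
    (∀ s, (f s : ℝ) / 2 ^ s ≤ (f (s + 1) : ℝ) / 2 ^ (s + 1)) ∧
    (∀ s, (g s : ℝ) / 2 ^ s ≤ (g (s + 1) : ℝ) / 2 ^ (s + 1)) ∧
    Tendsto (fun s => (f s : ℝ) / 2 ^ s) atTop (nhds (realOfSeq X)) ∧
    Tendsto (fun s => (g s : ℝ) / 2 ^ s) atTop (nhds (realOfSeq Y)) ∧
    ∀ s, realOfSeq X - (f s : ℝ) / 2 ^ s ≤ (c : ℝ) * (realOfSeq Y - (g s : ℝ) / 2 ^ s)


section part1
/-! ### Weights and Kraft -/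

/-- the weight `2^{-k}` -/
noncomputable def wt (k : ℕ) : ℝ := (1/2 : ℝ) ^ k

lemma wt_pos (k : ℕ) : 0 < wt k := by unfold wt; positivity
lemma wt_nonneg (k : ℕ) : 0 ≤ wt k := (wt_pos k).le
lemma wt_add (k l : ℕ) : wt (k + l) = wt k * wt l := by unfold wt; rw [pow_add]
lemma wt_zero : wt 0 = 1 := by simp [wt]
lemma wt_succ (k : ℕ) : wt (k+1) = wt k / 2 := by unfold wt; rw [pow_succ]; ring
lemma wt_le_one (k : ℕ) : wt k ≤ 1 := by unfold wt; exact pow_le_one₀ (by norm_num) (by norm_num)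
lemma wt_anti {k l : ℕ} (h : k ≤ l) : wt l ≤ wt k := by
  unfold wt; exact pow_le_pow_of_le_one (by norm_num) (by norm_num) h
lemma wt_mul_pow (k : ℕ) : wt k * 2 ^ k = 1 := by
  unfold wt; rw [← mul_pow]; norm_num
lemma wt_scale {k T : ℕ} (h : k ≤ T) : wt k * 2 ^ T = 2 ^ (T - k) := by
  obtain ⟨d, rfl⟩ := Nat.exists_eq_add_of_le h
  rw [pow_add, ← mul_assoc, wt_mul_pow]; simp

lemma sum_wt_range (a N : ℕ) : ∑ i ∈ Finset.range N, wt (a + i) + 2 * wt (a + N) = 2 * wt a := by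
  induction N with
  | zero => simp
  | succ n ih => rw [Finset.sum_range_succ, ← add_assoc, wt_succ]; linarith

lemma sum_wt_finset (a : ℕ) (S : Finset ℕ) (h : ∀ i ∈ S, a ≤ i) : ∑ i ∈ S, wt i ≤ 2 * wt a := by
  have h1 : S ⊆ (Finset.range (S.sup id + 1)).image (a + ·) := by
    intro i hi
    have h2 : i ≤ S.sup id := Finset.le_sup (f := id) hi
    have := h i hi
    simp only [Finset.mem_image, Finset.mem_range]
    exact ⟨i - a, by omega, by omega⟩
  calc ∑ i ∈ S, wt i ≤ ∑ i ∈ (Finset.range (S.sup id + 1)).image (a + ·), wt i :=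
        Finset.sum_le_sum_of_subset_of_nonneg h1 (fun i _ _ => wt_nonneg i)
    _ = ∑ i ∈ Finset.range (S.sup id + 1), wt (a + i) := by
        rw [Finset.sum_image]; intro x _ y _ hxy; simpa using hxy
    _ ≤ 2 * wt a := by
        have := sum_wt_range a (S.sup id + 1)
        have := wt_nonneg (a + (S.sup id + 1))
        linarith

lemma prefixfree_ud (S : Set Str) (h0 : [] ∉ S)
    (h : ∀ x ∈ S, ∀ y ∈ S, x <+: y → x = y) : InformationTheory.UniquelyDecodable S := by
  intro L₁
  induction L₁ with
  | nil =>
    intro L₂ _ h2 he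
    cases L₂ with
    | nil => rfl
    | cons y L =>
      have hy := h2 y (by simp)
      simp at he
      rw [he.1] at hy
      exact absurd hy h0
  | cons x L₁ ih =>
    intro L₂ h1 h2 he
    cases L₂ with
    | nil =>
      have hy := h1 x (by simp)
      simp at he
      rw [he.1] at hy
      exact absurd hy h0
    | cons y L₂ =>
      have hx := h1 x (by simp)
      have hy := h2 y (by simp)
      simp only [List.flatten_cons] at he
      have hxy : x = y := by
        have hp1 : x <+: x ++ L₁.flatten := List.prefix_append _ _
        have hp2 : y <+: x ++ L₁.flatten := by rw [he]; exact List.prefix_append _ _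
        rcases List.prefix_or_prefix_of_prefix hp1 hp2 with h3 | h3
        · exact h x hx y hy h3
        · exact (h y hy x hx h3).symm
      subst hxy
      rw [ih L₂ (fun w hw => h1 w (by simp [hw])) (fun w hw => h2 w (by simp [hw]))
        (List.append_cancel_left he)]

lemma kraft_prefixfree (S : Finset Str) (h : ∀ x ∈ S, ∀ y ∈ S, x <+: y → x = y) :
    ∑ x ∈ S, wt x.length ≤ 1 := by
  by_cases h0 : [] ∈ S
  · have : S = {[]} := by
      ext y
      constructor
      · intro hy
        simp [← h [] h0 y hy List.nil_prefix]
      · intro hy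
        rw [Finset.mem_singleton] at hy
        rw [hy]; exact h0
    rw [this]; simp [wt]
  · have := InformationTheory.kraft_mcmillan_inequality
      (prefixfree_ud (S : Set Str) (by simpa using h0) (by simpa using h))
    simpa [wt] using this

lemma kraft_machine {U : Str →. Str} (hU : PFMachine U) (S : Finset (ℕ × Str))
    (hS : ∀ q ∈ S, ∃ σ : Str, σ.length = q.1 ∧ q.2 ∈ U σ) : ∑ q ∈ S, wt q.1 ≤ 1 := by
  have hS' : ∀ q : ℕ × Str, ∃ σ : Str, q ∈ S → (σ.length = q.1 ∧ q.2 ∈ U σ) := by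
    intro q
    by_cases hq : q ∈ S
    · obtain ⟨σ, h⟩ := hS q hq; exact ⟨σ, fun _ => h⟩
    · exact ⟨[], fun h => absurd h hq⟩
  choose g hg using hS'
  have hinj : Set.InjOn g (S : Set (ℕ × Str)) := by
    intro p hp q hq h
    have h1 := hg p hp
    have h2 := hg q hq
    rw [h] at h1
    exact Prod.ext (h1.1.symm.trans h2.1) (Part.mem_unique h1.2 h2.2)
  have := kraft_prefixfree (S.image g) (by
    intro x hx y hy hxy
    obtain ⟨p, hp, rfl⟩ := Finset.mem_image.1 hx
    obtain ⟨q, hq, rfl⟩ := Finset.mem_image.1 hy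
    exact hU.2 _ _ (Part.dom_iff_mem.2 ⟨_, (hg p hp).2⟩) (Part.dom_iff_mem.2 ⟨_, (hg q hq).2⟩) hxy)
  rw [Finset.sum_image hinj] at this
  refine le_trans (le_of_eq ?_) this
  exact Finset.sum_congr rfl (fun q hq => by rw [(hg q hq).1])

/-! ### complexity basics -/

lemma KC_le {M : Str →. Str} {σ τ : Str} (h : τ ∈ M σ) : KC M τ ≤ σ.length :=
  iInf_le (fun ρ : {ρ : Str // τ ∈ M ρ} => ((ρ : Str).length : ℕ∞)) ⟨σ, h⟩

lemma KC_attained {M : Str →. Str} {τ : Str} (h : KC M τ ≠ ⊤) :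
    ∃ σ, τ ∈ M σ ∧ KC M τ = σ.length := by
  have hne : Nonempty {ρ : Str // τ ∈ M ρ} := by
    by_contra hc
    rw [not_nonempty_iff] at hc
    apply h
    unfold KC
    exact iInf_of_empty _
  have := ciInf_mem (fun ρ : {ρ : Str // τ ∈ M ρ} => ((ρ : Str).length : ℕ∞))
  obtain ⟨⟨σ, hσ⟩, h2⟩ := this
  exact ⟨σ, hσ, h2.symm⟩

/-! ### primitive recursive helpers -/

section prim
variable {α β : Type} [Primcodable α] [Primcodable β]

lemma primrec_sum {f : α → ℕ → ℕ} {g : α → ℕ} (hf : Primrec₂ f) (hg : Primrec g) :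
    Primrec fun a => ∑ i ∈ Finset.range (g a), f a i := by
  have h : Primrec fun a => Nat.rec (motive := fun _ => ℕ) 0 (fun i s => s + f a i) (g a) := by
    refine Primrec.nat_rec' (h := fun a p => p.2 + f a p.1) hg (Primrec.const 0) ?_
    exact Primrec.nat_add.comp (Primrec.snd.comp Primrec.snd)
      (hf.comp Primrec.fst (Primrec.fst.comp Primrec.snd))
  refine h.of_eq ?_
  intro a
  induction g a with
  | zero => simp
  | succ n ih => rw [Finset.sum_range_succ, ← ih]

lemma primrec_pow : Primrec₂ (fun a b : ℕ => a ^ b) := by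
  have h : Primrec fun p : ℕ × ℕ => Nat.rec (motive := fun _ => ℕ) 1 (fun _ s => s * p.1) p.2 := by
    refine Primrec.nat_rec' (h := fun a p => p.2 * a.1) Primrec.snd (Primrec.const 1) ?_
    exact Primrec.nat_mul.comp (Primrec.snd.comp Primrec.snd) (Primrec.fst.comp Primrec.fst)
  refine h.of_eq ?_
  rintro ⟨a, b⟩
  induction b with
  | zero => simp
  | succ n ih => simp only [pow_succ]; simp only at ih; rw [ih]

lemma pp_exists_lt {R : α → ℕ → Prop} {g : α → ℕ} (hR : PrimrecRel R) (hg : Primrec g) :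
    PrimrecPred fun a => ∃ i < g a, R a i := by
  have h1 : PrimrecRel fun (x : ℕ) (a : α) => R a x :=
    hR.comp Primrec.snd Primrec.fst
  have h2 := PrimrecRel.exists_mem_list h1
  exact (h2.comp (Primrec.list_range.comp hg) Primrec.id).of_eq (by simp)

lemma pp_forall_lt {R : α → ℕ → Prop} {g : α → ℕ} (hR : PrimrecRel R) (hg : Primrec g) :
    PrimrecPred fun a => ∀ i < g a, R a i := by
  have h1 : PrimrecRel fun (x : ℕ) (a : α) => R a x :=
    hR.comp Primrec.snd Primrec.fst
  have h2 := PrimrecRel.forall_mem_list h1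
  exact (h2.comp (Primrec.list_range.comp hg) Primrec.id).of_eq (by simp)

lemma pp_eq {f g : α → β} (hf : Primrec f) (hg : Primrec g) : PrimrecPred fun a => f a = g a :=
  Primrec.eq.comp hf hg
lemma pp_lt {f g : α → ℕ} (hf : Primrec f) (hg : Primrec g) : PrimrecPred fun a => f a < g a :=
  Primrec.nat_lt.comp hf hg
lemma pp_le {f g : α → ℕ} (hf : Primrec f) (hg : Primrec g) : PrimrecPred fun a => f a ≤ g a :=
  Primrec.nat_le.comp hf hg
lemma pp_imp {p q : α → Prop} (hp : PrimrecPred p) (hq : PrimrecPred q) :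
    PrimrecPred fun a => p a → q a :=
  (hp.not.or hq).of_eq (fun a => by tauto)
lemma pr_ite {p : α → Prop} [DecidablePred p] {f g : α → β} (hp : PrimrecPred p) (hf : Primrec f) (hg : Primrec g) :
    Primrec fun a => if p a then f a else g a := Primrec.ite hp hf hg
end prim

/-! ### enumerations -/

lemma nice_enum {α : Type} [Primcodable α] (f : ℕ → Option α) (hf : Primrec f) :
    ∃ e : ℕ → Option α, Primrec e ∧ (∀ s x, e s = Option.some x → Encodable.encode x ≤ s) ∧
      (∀ x, (∃ s, f s = Option.some x) ↔ ∃ s, e s = Option.some x) ∧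
      (∀ s s' x, e s = Option.some x → e s' = Option.some x → s = s') := by
  let g : ℕ → Option α := fun s =>
    if Encodable.encode (f (Nat.unpair s).1) ≤ s + 1 then f (Nat.unpair s).1 else Option.none
  have hfu : Primrec fun s => f (Nat.unpair s).1 := hf.comp (Primrec.fst.comp Primrec.unpair)
  have hg : Primrec g := pr_ite (pp_le (Primrec.encode.comp hfu) Primrec.succ) hfu (Primrec.const Option.none)
  have hgb : ∀ s x, g s = Option.some x → Encodable.encode x ≤ s := by
    intro s x h
    by_cases hc : Encodable.encode (f (Nat.unpair s).1) ≤ s + 1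
    · simp only [g, if_pos hc] at h
      rw [h] at hc
      simpa using hc
    · simp [g, if_neg hc] at h
  have hgs : ∀ x, (∃ s, f s = Option.some x) ↔ ∃ s, g s = Option.some x := by
    intro x
    constructor
    · rintro ⟨s, hs⟩
      refine ⟨Nat.pair s (Encodable.encode x), ?_⟩
      simp only [g, Nat.unpair_pair, hs]
      rw [if_pos]
      simp [Nat.right_le_pair]
    · rintro ⟨s, hs⟩
      by_cases hc : Encodable.encode (f (Nat.unpair s).1) ≤ s + 1
      · simp only [g, if_pos hc] at hs
        exact ⟨_, hs⟩
      · simp [g, if_neg hc] at hs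
  let e : ℕ → Option α := fun s => if ∃ i < s, g i = g s then Option.none else g s
  have hes : ∀ s x, e s = Option.some x → g s = Option.some x ∧ ∀ i < s, g i ≠ Option.some x := by
    intro s x h
    by_cases hc : ∃ i < s, g i = g s
    · simp [e, if_pos hc] at h
    · simp only [e, if_neg hc] at h
      refine ⟨h, fun i hi h2 => hc ⟨i, hi, by rw [h, h2]⟩⟩
  refine ⟨e, ?_, ?_, ?_, ?_⟩
  · refine pr_ite ?_ (Primrec.const Option.none) hg
    refine pp_exists_lt ?_ Primrec.id
    exact pp_eq (hg.comp Primrec.snd) (hg.comp Primrec.fst)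
  · intro s x h
    exact hgb s x (hes s x h).1
  · intro x
    rw [hgs x]
    constructor
    · intro h
      refine ⟨Nat.find h, ?_⟩
      have h1 := Nat.find_spec h
      have h2 : ¬ ∃ i < Nat.find h, g i = g (Nat.find h) := by
        rintro ⟨i, hi, h3⟩
        exact Nat.find_min h hi (h3.trans h1)
      simp only [e, if_neg h2, h1]
    · rintro ⟨s, hs⟩
      exact ⟨s, (hes s x hs).1⟩
  · intro s s' x h h'
    rcases lt_trichotomy s s' with hl | hl | hl
    · exact absurd (hes s x h).1 ((hes s' x h').2 s hl)
    · exact hl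
    · exact absurd (hes s' x h').1 ((hes s x h).2 s' hl)

/-! ### binary values -/

/-- value of a binary string -/
def bval (ρ : Str) : ℕ := ρ.foldl (fun a b => 2 * a + cond b 1 0) 0

lemma bval_append_one (ρ : Str) (b : Bool) : bval (ρ ++ [b]) = 2 * bval ρ + cond b 1 0 := by
  simp [bval]

lemma bval_append (ρ x : Str) : bval ρ * 2 ^ x.length ≤ bval (ρ ++ x) ∧
    bval (ρ ++ x) < (bval ρ + 1) * 2 ^ x.length := by
  induction x using List.reverseRecOn with
  | nil => simp
  | append_singleton x b ih =>
    rw [← List.append_assoc, bval_append_one, List.length_append, List.length_singleton, pow_succ]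
    cases b <;> simp only [cond_true, cond_false] <;> constructor <;> nlinarith [ih.1, ih.2]

lemma exists_bval (L N : ℕ) (h : N < 2 ^ L) : ∃ ρ : Str, ρ.length = L ∧ bval ρ = N := by
  induction L generalizing N with
  | zero => exact ⟨[], rfl, by simp at h; simp [bval, h]⟩
  | succ L ih =>
    obtain ⟨ρ, h1, h2⟩ := ih (N / 2) (by rw [pow_succ] at h; omega)
    refine ⟨ρ ++ [decide (N % 2 = 1)], by simp [h1], ?_⟩
    rw [bval_append_one, h2]
    rcases Nat.mod_two_eq_zero_or_one N with h3 | h3 <;> simp [h3] <;> omega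

lemma primrec_bval : Primrec bval := by
  unfold bval
  refine Primrec.list_foldl (h := fun (_ : Str) p => 2 * p.1 + cond p.2 1 0) Primrec.id (Primrec.const 0) ?_
  refine Primrec.nat_add.comp (Primrec.nat_mul.comp (Primrec.const 2) (Primrec.fst.comp Primrec.snd)) ?_
  exact Primrec.cond (Primrec.snd.comp Primrec.snd) (Primrec.const 1) (Primrec.const 0)
end part1

section part2
/-- weight of an optional request -/
noncomputable def ewt (o : Option (ℕ × Str)) : ℝ := (o.map (fun q => wt q.1)).getD 0
/-- scaled weight of an optional request -/
def eS (T : ℕ) (o : Option (ℕ × Str)) : ℕ := (o.map (fun q => 2 ^ (T - q.1))).getD 0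

lemma ewt_some (q : ℕ × Str) : ewt (Option.some q) = wt q.1 := rfl
lemma ewt_none : ewt Option.none = 0 := rfl
lemma ewt_nonneg (o : Option (ℕ × Str)) : 0 ≤ ewt o := by
  cases o with
  | none => simp [ewt_none]
  | some q => rw [ewt_some]; exact wt_nonneg _

lemma eS_eq (T : ℕ) (o : Option (ℕ × Str)) (h : ∀ q, o = Option.some q → q.1 ≤ T) :
    (eS T o : ℝ) = ewt o * 2 ^ T := by
  cases o with
  | none => simp [ewt_none, eS]
  | some q => rw [ewt_some, wt_scale (h q rfl)]; simp [eS]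

lemma primrec_eS : Primrec₂ eS := by
  unfold eS
  refine Primrec.option_getD.comp ?_ (Primrec.const 0)
  refine Primrec.option_map Primrec.snd ?_
  exact primrec_pow.comp (Primrec.const 2) (Primrec.nat_sub.comp (Primrec.fst.comp Primrec.fst)
    (Primrec.fst.comp Primrec.snd))

lemma sum_enum_le (e : ℕ → Option (ℕ × Str))
    (hinj : ∀ s s' x, e s = Option.some x → e s' = Option.some x → s = s') (c : ℝ)
    (hw : ∀ S : Finset (ℕ × Str), (∀ q ∈ S, ∃ s, e s = Option.some q) → ∑ q ∈ S, wt q.1 ≤ c)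
    (J : Finset ℕ) : ∑ j ∈ J, ewt (e j) ≤ c := by
  have h1 : ∑ j ∈ J, ewt (e j) = ∑ j ∈ J.filter (fun j => (e j).isSome), ewt (e j) := by
    rw [Finset.sum_filter]
    refine Finset.sum_congr rfl (fun j _ => ?_)
    cases h : e j <;> simp [ewt_none]
  let g : ℕ → ℕ × Str := fun j => (e j).getD (0, [])
  have hg : ∀ j ∈ J.filter (fun j => (e j).isSome), e j = Option.some (g j) := by
    intro j hj
    have := (Finset.mem_filter.1 hj).2
    cases h : e j with
    | none => simp [h] at this
    | some q => simp [g, h]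
  have h2 := hw ((J.filter (fun j => (e j).isSome)).image g) (by
    intro q hq
    obtain ⟨j, hj, rfl⟩ := Finset.mem_image.1 hq
    exact ⟨j, hg j hj⟩)
  rw [Finset.sum_image] at h2
  · rw [h1]
    refine le_trans (le_of_eq ?_) h2
    exact Finset.sum_congr rfl (fun j hj => by rw [hg j hj, ewt_some])
  · intro x hx y hy hxy
    have a := hg x hx
    have b := hg y hy
    rw [hxy] at a
    exact hinj _ _ _ a b

/-- the left endpoint assigned at stage `s` -/
def kcN (e : ℕ → Option (ℕ × Str)) (C s k : ℕ) : ℕ :=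
  ((∑ j ∈ Finset.range s, eS s (e j)) * 2 ^ (k + C + 1) + (2 ^ (s + C) - 1)) / 2 ^ (s + C)

lemma kcN_bounds (e : ℕ → Option (ℕ × Str)) (hb : ∀ s q, e s = Option.some q → q.1 ≤ s)
    (C s k : ℕ) :
    (∑ j ∈ Finset.range s, ewt (e j)) * wt C ≤ kcN e C s k * wt (k + C + 1) ∧
    (kcN e C s k + 1) * wt (k + C + 1) <
      (∑ j ∈ Finset.range s, ewt (e j)) * wt C + wt (k + C) := by
  set P := ∑ j ∈ Finset.range s, ewt (e j) with hP
  have hS : ((∑ j ∈ Finset.range s, eS s (e j) : ℕ) : ℝ) = P * 2 ^ s := by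
    rw [hP, Finset.sum_mul]
    push_cast
    refine Finset.sum_congr rfl (fun j hj => ?_)
    apply eS_eq
    intro q hq
    exact (hb j q hq).trans (Finset.mem_range.1 hj).le
  set S := ∑ j ∈ Finset.range s, eS s (e j) with hSd
  set N := kcN e C s k with hN
  set D := 2 ^ (s + C) with hD
  have hDpos : 0 < D := by positivity
  have hNd : N = (S * 2 ^ (k + C + 1) + (D - 1)) / D := rfl
  have h1 : S * 2 ^ (k + C + 1) ≤ N * D := by
    have := Nat.lt_div_mul_add (a := S * 2 ^ (k + C + 1) + (D - 1)) hDpos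
    rw [← hNd] at this
    omega
  have h2 : N * D < S * 2 ^ (k + C + 1) + D := by
    have := Nat.div_mul_le_self (S * 2 ^ (k + C + 1) + (D - 1)) D
    rw [← hNd] at this
    omega
  have h1' : (S : ℝ) * 2 ^ (k + C + 1) ≤ N * D := by exact_mod_cast h1
  have h2' : (N : ℝ) * D < S * 2 ^ (k + C + 1) + D := by exact_mod_cast h2
  have hDr : (D : ℝ) = 2 ^ s * 2 ^ C := by rw [hD]; push_cast; rw [pow_add]
  rw [hS, hDr] at h1' h2'
  have w1 := wt_mul_pow C
  have w2 := wt_mul_pow s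
  have w3 := wt_mul_pow (k + C + 1)
  have hw : wt (k + C) = 2 * wt (k + C + 1) := by rw [wt_succ]; ring
  have e1 : P * wt C = (P * 2 ^ s * 2 ^ (k + C + 1)) * (wt s * wt C * wt (k + C + 1)) := by
    calc P * wt C = P * wt C * (wt s * 2 ^ s) * (wt (k + C + 1) * 2 ^ (k + C + 1)) := by
          rw [w2, w3]; ring
      _ = _ := by ring
  have e2 : N * wt (k + C + 1) = (N * (2 ^ s * 2 ^ C)) * (wt s * wt C * wt (k + C + 1)) := by
    calc N * wt (k + C + 1) = N * wt (k + C + 1) * (wt s * 2 ^ s) * (wt C * 2 ^ C) := by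
          rw [w2, w1]; ring
      _ = _ := by ring
  have e3 : wt (k + C + 1) = (2 ^ s * 2 ^ C) * (wt s * wt C * wt (k + C + 1)) := by
    calc wt (k + C + 1) = wt (k + C + 1) * (wt s * 2 ^ s) * (wt C * 2 ^ C) := by
          rw [w2, w1]; ring
      _ = _ := by ring
  have hpos : 0 < wt s * wt C * wt (k + C + 1) :=
    mul_pos (mul_pos (wt_pos _) (wt_pos _)) (wt_pos _)
  constructor
  · rw [e1, e2]
    exact mul_le_mul_of_nonneg_right h1' hpos.le
  · rw [add_mul, one_mul, hw]
    have : N * wt (k + C + 1) < P * wt C + wt (k + C + 1) := by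
      have := mul_lt_mul_of_pos_right h2' hpos
      rw [add_mul, ← e1, ← e2, ← e3] at this
      exact this
    linarith

lemma primrec_kcN (e : ℕ → Option (ℕ × Str)) (he : Primrec e) (C : ℕ) :
    Primrec fun x : ℕ × ℕ => kcN e C x.1 x.2 := by
  unfold kcN
  refine Primrec.nat_div.comp (Primrec.nat_add.comp (Primrec.nat_mul.comp ?_ ?_)
    (Primrec.nat_sub.comp ?_ (Primrec.const 1))) ?_
  · refine primrec_sum ?_ Primrec.fst
    exact primrec_eS.comp (Primrec.fst.comp Primrec.fst) (he.comp Primrec.snd)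
  · exact primrec_pow.comp (Primrec.const 2) (Primrec.nat_add.comp (Primrec.nat_add.comp
      Primrec.snd (Primrec.const _)) (Primrec.const _))
  · exact primrec_pow.comp (Primrec.const 2) (Primrec.nat_add.comp
      Primrec.fst (Primrec.const _))
  · exact primrec_pow.comp (Primrec.const 2) (Primrec.nat_add.comp
      Primrec.fst (Primrec.const _))

lemma primrec_kcG (e : ℕ → Option (ℕ × Str)) (he : Primrec e) (C : ℕ) (N : ℕ → ℕ → ℕ)
    (hN : Primrec fun x : ℕ × ℕ => N x.1 x.2) :
    Primrec₂ (fun (ρ : Str) (s : ℕ) => (e s).bind fun q =>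
    if ρ.length = q.1 + C + 1 ∧ bval ρ = N s q.1 then Option.some q.2 else Option.none) := by
  have h1 : PrimrecPred fun x : (Str × ℕ) × (ℕ × Str) => x.1.1.length = x.2.1 + C + 1 := by
    refine pp_eq ?_ ?_
    · exact Primrec.list_length.comp (Primrec.fst.comp Primrec.fst)
    · exact Primrec.nat_add.comp (Primrec.nat_add.comp
        (Primrec.fst.comp Primrec.snd) (Primrec.const _)) (Primrec.const _)
  have h2 : PrimrecPred fun x : (Str × ℕ) × (ℕ × Str) => bval x.1.1 = N x.1.2 x.2.1 := by
    refine pp_eq ?_ ?_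
    · exact primrec_bval.comp (Primrec.fst.comp Primrec.fst)
    · exact hN.comp (Primrec.pair (Primrec.snd.comp Primrec.fst) (Primrec.fst.comp Primrec.snd))
  have h3 : Primrec fun x : (Str × ℕ) × (ℕ × Str) =>
      if x.1.1.length = x.2.1 + C + 1 ∧ bval x.1.1 = N x.1.2 x.2.1 then Option.some x.2.2
      else Option.none :=
    pr_ite (h1.and h2) (Primrec.option_some.comp (Primrec.snd.comp Primrec.snd))
      (Primrec.const _)
  exact Primrec.option_bind (he.comp Primrec.snd) h3

lemma kc_lemma {U : Str →. Str} (hU : OptimalPF U) (f : ℕ → Option (ℕ × Str)) (hf : Primrec f)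
    (C : ℕ) (hw : ∀ S : Finset (ℕ × Str), (∀ q ∈ S, ∃ s, f s = Option.some q) →
      ∑ q ∈ S, wt q.1 ≤ 2 ^ C) :
    ∃ c : ℕ, ∀ s k τ, f s = Option.some (k, τ) → KC U τ ≤ ((k + c : ℕ) : ℕ∞) := by
  obtain ⟨e, he, hb, hfe, hinj⟩ := nice_enum f hf
  have hb1 : ∀ s q, e s = Option.some q → q.1 ≤ s := by
    rintro s ⟨k, τ⟩ h
    have := hb s _ h
    rw [Encodable.encode_prod_val] at this
    exact (Nat.left_le_pair _ _).trans this
  have hsum : ∀ s, ∑ j ∈ Finset.range s, ewt (e j) ≤ 2 ^ C := fun s =>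
    sum_enum_le e hinj _ (fun S hS => hw S (fun q hq => (hfe q).2 (hS q hq))) _
  set P : ℕ → ℝ := fun s => (∑ j ∈ Finset.range s, ewt (e j)) * wt C with hP
  have hPm : Monotone P := by
    intro a b hab
    refine mul_le_mul_of_nonneg_right ?_ (wt_nonneg _)
    refine Finset.sum_le_sum_of_subset_of_nonneg ?_ (fun _ _ _ => ewt_nonneg _)
    exact Finset.range_mono hab
  have hP1 : ∀ s, P s ≤ 1 := by
    intro s
    have := mul_le_mul_of_nonneg_right (hsum s) (wt_nonneg C)
    rw [mul_comm (2 ^ C), wt_mul_pow] at this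
    exact this
  have hPs : ∀ s q, e s = Option.some q → P (s + 1) = P s + wt (q.1 + C) := by
    intro s q h
    simp only [hP]
    rw [Finset.sum_range_succ, h, ewt_some, add_mul, wt_add]
  let G : Str → ℕ → Option Str := fun ρ s => (e s).bind fun q =>
    if ρ.length = q.1 + C + 1 ∧ bval ρ = kcN e C s q.1 then Option.some q.2 else Option.none
  have hGspec : ∀ ρ s τ, τ ∈ G ρ s → ∃ k, e s = Option.some (k, τ) ∧ ρ.length = k + C + 1 ∧
      bval ρ = kcN e C s k := by
    intro ρ s τ h
    simp only [G, Option.mem_def, Option.bind_eq_some_iff] at h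
    obtain ⟨⟨k, τ'⟩, h1, h2⟩ := h
    split_ifs at h2 with h3
    simp only [Option.some.injEq] at h2
    subst h2
    exact ⟨k, h1, h3⟩
  have hkcN := primrec_kcN e he C
  have hG : Primrec₂ G := by
    exact primrec_kcG e he C (kcN e C) hkcN
  -- key: prefix comparable descriptions come from the same stage
  have hkey0 : ∀ ρ₁ ρ₂ s₁ s₂ k₁ k₂ τ₁ τ₂, ρ₁ <+: ρ₂ → e s₁ = Option.some (k₁, τ₁) →
      e s₂ = Option.some (k₂, τ₂) → ρ₁.length = k₁ + C + 1 → ρ₂.length = k₂ + C + 1 →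
      bval ρ₁ = kcN e C s₁ k₁ → bval ρ₂ = kcN e C s₂ k₂ → s₁ = s₂ := by
    rintro ρ₁ _ s₁ s₂ k₁ k₂ τ₁ τ₂ ⟨x, rfl⟩ h1 h2 l1 l2 v1 v2
    have b1 := kcN_bounds e hb1 C s₁ k₁
    have b2 := kcN_bounds e hb1 C s₂ k₂
    change P s₁ ≤ _ ∧ _ < P s₁ + wt (k₁ + C) at b1
    change P s₂ ≤ _ ∧ _ < P s₂ + wt (k₂ + C) at b2
    rw [← v1] at b1
    rw [← v2] at b2
    have hx := bval_append ρ₁ x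
    have hlen : k₂ + C + 1 = k₁ + C + 1 + x.length := by
      rw [← l1, ← l2, List.length_append]
    have hx1 : (bval ρ₁ : ℝ) * 2 ^ x.length ≤ bval (ρ₁ ++ x) := by exact_mod_cast hx.1
    have hx2 : (bval (ρ₁ ++ x) : ℝ) + 1 ≤ (bval ρ₁ + 1) * 2 ^ x.length := by exact_mod_cast hx.2
    have hw2 : wt (k₂ + C + 1) * 2 ^ x.length = wt (k₁ + C + 1) := by
      rw [hlen, wt_add, mul_assoc, wt_mul_pow, mul_one]
    have q0 := wt_pos (k₂ + C + 1)
    have y1 : bval ρ₁ * wt (k₁ + C + 1) ≤ bval (ρ₁ ++ x) * wt (k₂ + C + 1) := by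
      rw [← hw2]
      have := mul_le_mul_of_nonneg_right hx1 q0.le
      linarith
    have y2 : (bval (ρ₁ ++ x) + 1) * wt (k₂ + C + 1) ≤ (bval ρ₁ + 1) * wt (k₁ + C + 1) := by
      rw [← hw2]
      have := mul_le_mul_of_nonneg_right hx2 q0.le
      linarith
    have z1 := hPs s₁ _ h1
    have z2 := hPs s₂ _ h2
    simp only at z1 z2
    rcases lt_trichotomy s₁ s₂ with hl | hl | hl
    · have := hPm (show s₁ + 1 ≤ s₂ from hl)
      nlinarith
    · exact hl
    · have := hPm (show s₂ + 1 ≤ s₁ from hl)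
      nlinarith
  let M : Str →. Str := fun ρ => Nat.rfindOpt (G ρ)
  have hM : PFMachine M := by
    refine ⟨Partrec.rfindOpt hG.to_comp, ?_⟩
    intro ρ₁ ρ₂ d1 d2 hp
    obtain ⟨τ₁, m1⟩ := Part.dom_iff_mem.1 d1
    obtain ⟨τ₂, m2⟩ := Part.dom_iff_mem.1 d2
    obtain ⟨s₁, g1⟩ := Nat.rfindOpt_spec m1
    obtain ⟨s₂, g2⟩ := Nat.rfindOpt_spec m2
    obtain ⟨k₁, a1, a2, a3⟩ := hGspec _ _ _ g1
    obtain ⟨k₂, c1, c2, c3⟩ := hGspec _ _ _ g2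
    have := hkey0 _ _ _ _ _ _ _ _ hp a1 c1 a2 c2 a3 c3
    subst this
    rw [a1] at c1
    simp only [Option.some.injEq, Prod.mk.injEq] at c1
    exact hp.eq_of_length (by rw [a2, c2, c1.1])
  obtain ⟨c, hc⟩ := hU.2 M hM
  refine ⟨C + 1 + c, ?_⟩
  intro s0 k τ hs0
  obtain ⟨s, hs⟩ := (hfe (k, τ)).1 ⟨s0, hs0⟩
  have hlt : kcN e C s k < 2 ^ (k + C + 1) := by
    have b := (kcN_bounds e hb1 C s k).2
    change _ < P s + wt (k + C) at b
    have := hPs s _ hs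
    simp only at this
    rw [← this] at b
    have b2 := b.trans_le (hP1 _)
    have b3 := mul_lt_mul_of_pos_right b2 (show (0:ℝ) < 2 ^ (k + C + 1) by positivity)
    rw [mul_assoc, wt_mul_pow, mul_one, one_mul] at b3
    have : (kcN e C s k : ℝ) < (2 ^ (k + C + 1) : ℕ) := by push_cast; linarith
    exact_mod_cast this
  obtain ⟨ρ, l1, v1⟩ := exists_bval _ _ hlt
  have hmem : τ ∈ G ρ s := by
    simp [G, hs, l1, v1]
  have hMρ : τ ∈ M ρ := by
    have hd : (M ρ).Dom := Nat.rfindOpt_dom.2 ⟨s, τ, hmem⟩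
    obtain ⟨τ', m⟩ := Part.dom_iff_mem.1 hd
    obtain ⟨s', g'⟩ := Nat.rfindOpt_spec m
    obtain ⟨k', c1, c2, c3⟩ := hGspec _ _ _ g'
    have := hkey0 _ _ _ _ _ _ _ _ (List.prefix_refl ρ) c1 hs c2 l1 c3 v1
    subst this
    rw [hs] at c1
    simp only [Option.some.injEq, Prod.mk.injEq] at c1
    rw [c1.2]; exact m
  calc KC U τ ≤ KC M τ + c := hc τ
    _ ≤ (ρ.length : ℕ∞) + c := by gcongr; exact KC_le hMρ
    _ = ((k + (C + 1 + c) : ℕ) : ℕ∞) := by rw [l1]; push_cast; ring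

lemma KC_ne_top {U : Str →. Str} (hU : OptimalPF U) (τ : Str) : KC U τ ≠ ⊤ := by
  let f : ℕ → Option (ℕ × Str) := fun s =>
    (Encodable.decode (α := Str) s).map (fun τ => (s + 1, τ))
  have hf : Primrec f := Primrec.option_map Primrec.decode
    (Primrec.pair (Primrec.succ.comp Primrec.fst) Primrec.snd)
  obtain ⟨c, hc⟩ := kc_lemma hU f hf 0 (by
    intro S hS
    have hq : ∀ q ∈ S, Encodable.decode (α := Str) (q.1 - 1) = Option.some q.2 ∧ 1 ≤ q.1 := by
      intro q hq
      obtain ⟨s, hs⟩ := hS q hq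
      simp only [f, Option.map_eq_some_iff] at hs
      obtain ⟨τ, h1, rfl⟩ := hs
      simpa using h1
    have : ∑ q ∈ S, wt q.1 = ∑ i ∈ S.image Prod.fst, wt i := by
      rw [Finset.sum_image]
      intro x hx y hy hxy
      have h1 := (hq x hx).1
      have h2 := (hq y hy).1
      rw [hxy, h2] at h1
      exact Prod.ext hxy (Option.some.inj h1).symm
    rw [this]
    have := sum_wt_finset 1 (S.image Prod.fst) (by
      intro i hi
      obtain ⟨q, h1, rfl⟩ := Finset.mem_image.1 hi
      exact (hq q h1).2)
    rw [wt_succ, wt_zero] at this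
    simpa using this)
  have := hc (Encodable.encode τ) (Encodable.encode τ + 1) τ (by simp [f])
  intro h
  rw [h] at this
  exact absurd (top_le_iff.1 this) (ENat.natCast_ne_top _)
end part2

section part3
open Nat.Partrec (Code)

lemma U_enum {U : Str →. Str} (hU : Partrec U) : ∃ e : ℕ → Option (ℕ × Str), Primrec e ∧
    (∀ j k τ, e j = Option.some (k, τ) → k ≤ j ∧ τ.length ≤ j) ∧
    (∀ s s' x, e s = Option.some x → e s' = Option.some x → s = s') ∧
    (∀ k τ, (∃ j, e j = Option.some (k, τ)) ↔ ∃ σ : Str, σ.length = k ∧ τ ∈ U σ) := by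
  obtain ⟨c, hc⟩ := Code.exists_code.1 hU
  let f : ℕ → Option (ℕ × Str) := fun s =>
    (Encodable.decode (α := Str) s.unpair.2).bind fun σ =>
      (Code.evaln s.unpair.1 c s.unpair.2).bind fun r =>
        (Encodable.decode (α := Str) r).map fun τ => (σ.length, τ)
  have hf : Primrec f := by
    have h2 : Primrec fun s : ℕ => s.unpair.2 := Primrec.snd.comp Primrec.unpair
    have h1 : Primrec fun s : ℕ => s.unpair.1 := Primrec.fst.comp Primrec.unpair
    refine Primrec.option_bind (Primrec.decode.comp h2) ?_
    refine Primrec.option_bind ?_ ?_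
    · exact Code.primrec_evaln.comp (Primrec.pair (Primrec.pair (h1.comp Primrec.fst)
        (Primrec.const c)) (h2.comp Primrec.fst))
    · refine Primrec.option_map (Primrec.decode.comp Primrec.snd) ?_
      exact Primrec.pair (Primrec.list_length.comp (Primrec.snd.comp (Primrec.fst.comp Primrec.fst)))
        Primrec.snd
  have hspec : ∀ k τ, (∃ j, f j = Option.some (k, τ)) ↔ ∃ σ : Str, σ.length = k ∧ τ ∈ U σ := by
    intro k τ
    constructor
    · rintro ⟨s, hs⟩
      simp only [f, Option.bind_eq_some_iff, Option.map_eq_some_iff, Prod.mk.injEq] at hs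
      obtain ⟨σ, h1, r, h2, τ', h3, h4, h5⟩ := hs
      subst h5
      refine ⟨σ, h4, ?_⟩
      have h6 := Code.evaln_sound (Option.mem_def.2 h2)
      rw [hc] at h6
      change r ∈ ((Encodable.decode (α := Str) s.unpair.2 : Option Str) : Part Str).bind
        (fun a => Part.map Encodable.encode (U a)) at h6
      rw [h1] at h6
      rw [Part.coe_some, Part.bind_some, Part.mem_map_iff] at h6
      obtain ⟨τ'', h7, h8⟩ := h6
      rw [← h8, Encodable.encodek] at h3
      rw [← Option.some.inj h3]
      exact h7
    · rintro ⟨σ, h1, h2⟩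
      have h3 : Encodable.encode τ ∈ Code.eval c (Encodable.encode σ) := by
        rw [hc]
        simp only [Encodable.encodek, Part.coe_some, Part.bind_some, Part.mem_map_iff]
        exact ⟨τ, h2, rfl⟩
      obtain ⟨m, hm⟩ := Code.evaln_complete.1 h3
      refine ⟨Nat.pair m (Encodable.encode σ), ?_⟩
      simp only [f, Nat.unpair_pair, Encodable.encodek, Option.bind_some]
      rw [Option.mem_def.1 hm]
      simp [h1]
  obtain ⟨e, he, hb, hfe, hinj⟩ := nice_enum f hf
  refine ⟨e, he, ?_, hinj, ?_⟩
  · intro j k τ h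
    have := hb _ _ h
    rw [Encodable.encode_prod_val] at this
    refine ⟨(Nat.left_le_pair _ _).trans this, ?_⟩
    exact (Encodable.length_le_encode τ).trans ((Nat.right_le_pair _ _).trans this)
  · intro k τ
    rw [← hfe, hspec]

lemma ce_approx {A : Set ℕ} (hA : CESet A) : ∃ a : ℕ → ℕ → Bool, Primrec₂ a ∧
    (∀ s t i, s ≤ t → a s i = true → a t i = true) ∧ (∀ i, i ∈ A ↔ ∃ s, a s i = true) := by
  obtain ⟨f, hf, hA⟩ := hA
  obtain ⟨c, hc⟩ := Code.exists_code.1 hf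
  refine ⟨fun s i => (Code.evaln s c i).isSome, ?_, ?_, ?_⟩
  · exact Primrec.option_isSome.comp (Code.primrec_evaln.comp (Primrec.pair (Primrec.pair Primrec.fst
        (Primrec.const c)) Primrec.snd))
  · intro s t i hst h
    rw [Option.isSome_iff_exists] at h ⊢
    obtain ⟨x, hx⟩ := h
    exact ⟨x, Code.evaln_mono hst hx⟩
  · intro i
    rw [hA, ← hc, Part.dom_iff_mem]
    simp only [Option.isSome_iff_exists]
    constructor
    · rintro ⟨y, hy⟩
      obtain ⟨m, hm⟩ := Code.evaln_complete.1 hy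
      exact ⟨m, y, hm⟩
    · rintro ⟨m, y, hm⟩
      exact ⟨y, Code.evaln_sound hm⟩

lemma halting_approx : ∃ a : ℕ → ℕ → Bool, Primrec₂ a ∧
    (∀ s t i, s ≤ t → a s i = true → a t i = true) ∧
    (∀ i, i ∈ haltingSet ↔ ∃ s, a s i = true) := by
  refine ⟨fun s i => (Code.evaln s (Denumerable.ofNat Code i) i).isSome, ?_, ?_, ?_⟩
  · exact Primrec.option_isSome.comp (Code.primrec_evaln.comp (Primrec.pair (Primrec.pair Primrec.fst
        ((Primrec.ofNat Code).comp Primrec.snd)) Primrec.snd))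
  · intro s t i hst h
    rw [Option.isSome_iff_exists] at h ⊢
    obtain ⟨x, hx⟩ := h
    exact ⟨x, Code.evaln_mono hst hx⟩
  · intro i
    simp only [haltingSet, Set.mem_ofPred_eq]
    rw [Part.dom_iff_mem]
    simp only [Option.isSome_iff_exists]
    constructor
    · rintro ⟨y, hy⟩
      obtain ⟨m, hm⟩ := Code.evaln_complete.1 hy
      exact ⟨m, y, hm⟩
    · rintro ⟨m, y, hm⟩
      exact ⟨y, Code.evaln_sound hm⟩

/-! ### oracle computations -/

lemma recIn_of_partrec {O : ℕ →. ℕ} {f : ℕ →. ℕ} (hf : Nat.Partrec f) : RecursiveIn O f := by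
  induction hf with
  | zero => exact RecursiveIn.zero
  | succ => exact RecursiveIn.succ
  | left => exact RecursiveIn.left
  | right => exact RecursiveIn.right
  | pair _ _ h1 h2 => exact RecursiveIn.pair h1 h2
  | comp _ _ h1 h2 => exact RecursiveIn.comp h1 h2
  | prec _ _ h1 h2 => exact RecursiveIn.prec h1 h2
  | rfind _ h1 => exact RecursiveIn.rfind h1

lemma pbind (f : ℕ →. ℕ) (x : ℕ) : (Part.some x >>= f) = f x := Part.bind_some x f
lemma ppair (x y : ℕ) : (Nat.pair <$> Part.some x <*> Part.some y) = Part.some (Nat.pair x y) := by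
  simp [Seq.seq]

/-- every c.e. set is Turing below the halting set -/
lemma ce_le_halting {B : Set ℕ} (hB : CESet B) : TuringLeSet B haltingSet := by
  obtain ⟨f, hf, hB⟩ := hB
  obtain ⟨c, hc⟩ := Code.exists_code.1 hf
  -- code ignoring its argument and running `c` on `n`
  let g : ℕ → ℕ := fun n => Encodable.encode (Code.comp c (Code.const n))
  have hg : Primrec g :=
    Primrec.encode.comp (Code.primrec₂_comp.comp (Primrec.const c) Code.primrec_const)
  have hgs : ∀ n, n ∈ B ↔ g n ∈ haltingSet := by
    intro n
    rw [hB, ← hc]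
    simp only [haltingSet, g, Set.mem_ofPred_eq, Denumerable.ofNat_encode]
    have : (c.comp (Code.const n)).eval (Encodable.encode (c.comp (Code.const n))) = c.eval n := by
      change (Code.const n).eval _ >>= c.eval = _
      rw [Code.eval_const]
      exact pbind _ _
    rw [this]
  unfold TuringLeSet
  have h1 : RecursiveIn (chi haltingSet) (fun n => (↑g : ℕ →. ℕ) n >>= chi haltingSet) :=
    RecursiveIn.comp RecursiveIn.oracle
      (recIn_of_partrec (Partrec.nat_iff.1 hg.to_comp.partrec))
  have heq : chi B = fun n => (↑g : ℕ →. ℕ) n >>= chi haltingSet := by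
    funext n
    have : (↑g : ℕ →. ℕ) n = Part.some (g n) := rfl
    rw [this, pbind]
    simp only [chi, hgs n]
  rw [heq]; exact h1

/-- a search with one oracle query per candidate -/
lemma search_le {B H : Set ℕ} (q : ℕ → ℕ → Bool) (hq : Primrec₂ q) (o : ℕ → ℕ → Bool)
    (ho : Primrec₂ o) (hex : ∀ n, ∃ v, v ∉ B ∧ q n v = true)
    (hco : ∀ n v, v ∉ B → q n v = true → (n ∈ H ↔ o n v = true)) : TuringLeSet H B := by
  unfold TuringLeSet
  -- test function
  let T : ℕ →. ℕ := fun x => (↑(fun x : ℕ => x.unpair.2) : ℕ →. ℕ) x >>= chi B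
  have hT : RecursiveIn (chi B) T := RecursiveIn.comp RecursiveIn.oracle RecursiveIn.right
  let F : ℕ → ℕ := fun z => if q z.unpair.1.unpair.1 z.unpair.1.unpair.2 = true ∧ z.unpair.2 = 0
    then 0 else 1
  have hF : Primrec F := by
    have hu1 : Primrec fun s : ℕ => s.unpair.1 := Primrec.fst.comp Primrec.unpair
    have hu2 : Primrec fun s : ℕ => s.unpair.2 := Primrec.snd.comp Primrec.unpair
    refine pr_ite (PrimrecPred.and (pp_eq ?_ (Primrec.const _)) (pp_eq hu2 (Primrec.const _)))
      (Primrec.const _) (Primrec.const _)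
    exact hq.comp (hu1.comp hu1) (hu2.comp hu1)
  let W : ℕ →. ℕ := fun x => (Nat.pair <$> (↑(id : ℕ → ℕ) : ℕ →. ℕ) x <*> T x) >>= (↑F : ℕ →. ℕ)
  have hW : RecursiveIn (chi B) W :=
    RecursiveIn.comp (recIn_of_partrec (Partrec.nat_iff.1 hF.to_comp.partrec))
      (RecursiveIn.pair (recIn_of_partrec (Partrec.nat_iff.1 Computable.id.partrec)) hT)
  have hWv : ∀ n v, W (Nat.pair n v) =
      Part.some (if q n v = true ∧ v ∉ B then 0 else 1) := by
    intro n v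
    have h1 : T (Nat.pair n v) = chi B v := by
      have : (↑(fun x : ℕ => x.unpair.2) : ℕ →. ℕ) (Nat.pair n v) = Part.some v := by
        simp
      simp only [T]
      rw [this, pbind]
    simp only [W]
    rw [h1]
    have h2 : (↑(id : ℕ → ℕ) : ℕ →. ℕ) (Nat.pair n v) = Part.some (Nat.pair n v) := rfl
    rw [h2]
    simp only [chi]
    rw [ppair, pbind, PFun.coe_val]
    simp only [F, Nat.unpair_pair]
    by_cases hv : v ∈ B <;> simp [hv]
  let S : ℕ →. ℕ := fun a => Nat.rfind fun n => (fun m => (m = 0 : Bool)) <$> W (Nat.pair a n)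
  have hS : RecursiveIn (chi B) S := RecursiveIn.rfind hW
  let G : ℕ → ℕ := fun z => cond (o z.unpair.1 z.unpair.2) 1 0
  have hG : Primrec G := by
    have hu1 : Primrec fun s : ℕ => s.unpair.1 := Primrec.fst.comp Primrec.unpair
    have hu2 : Primrec fun s : ℕ => s.unpair.2 := Primrec.snd.comp Primrec.unpair
    exact Primrec.cond (ho.comp hu1 hu2) (Primrec.const 1) (Primrec.const 0)
  have hfin : RecursiveIn (chi B)
      (fun x => (Nat.pair <$> (↑(id : ℕ → ℕ) : ℕ →. ℕ) x <*> S x) >>= (↑G : ℕ →. ℕ)) :=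
    RecursiveIn.comp (recIn_of_partrec (Partrec.nat_iff.1 hG.to_comp.partrec))
      (RecursiveIn.pair (recIn_of_partrec (Partrec.nat_iff.1 Computable.id.partrec)) hS)
  refine (congrArg (RecursiveIn (chi B)) ?_).mpr hfin
  funext n
  have hdom : (S n).Dom := by
    refine Nat.rfind_dom.2 ?_
    obtain ⟨v, h1, h2⟩ := hex n
    refine ⟨v, ?_, ?_⟩
    · rw [hWv]; simp [h1, h2]
    · intro m _; rw [hWv]; simp
  obtain ⟨v, hv⟩ := Part.dom_iff_mem.1 hdom
  have hspec := Nat.rfind_spec hv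
  rw [hWv] at hspec
  simp only [Part.map_eq_map, Part.map_some, Part.mem_some_iff] at hspec
  have hcond : q n v = true ∧ v ∉ B := by
    by_contra hc
    simp [hc] at hspec
  have hSv : S n = Part.some v := Part.eq_some_iff.2 hv
  have := hco n v hcond.2 hcond.1
  have h2 : (↑(id : ℕ → ℕ) : ℕ →. ℕ) n = Part.some n := rfl
  rw [hSv, h2, ppair, pbind, PFun.coe_val]
  simp only [G, chi, Nat.unpair_pair]
  by_cases hn : n ∈ H
  · rw [if_pos hn, this.1 hn]; rfl
  · rw [if_neg hn]
    have : o n v = false := by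
      cases ho' : o n v with
      | false => rfl
      | true => exact absurd (this.2 ho') hn
    rw [this]; rfl
end part3

section part4
/-! ### The construction: definitions -/

/-- The stage-wise data: an enumeration of the pairs (length, output) of the universal machine
(index `j` is valid if `V j`), and enumerations of the given set and of the halting set. -/
structure CData where
  V : ℕ → Bool
  k : ℕ → ℕ
  τ : ℕ → Str
  a : ℕ → ℕ → Bool
  h : ℕ → ℕ → Bool

namespace CData
variable (d : CData) (p : ℕ → ℕ)

/-- length of the output of the `j`-th pair -/
def m (j : ℕ) : ℕ := (d.τ j).length
/-- stage `s` approximation of the given set, restricted to `t` -/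
def AS (s t : ℕ) : Str := (List.range t).map (d.a s)
/-- the `i`-th pair describes a string of zeros -/
def Z (i : ℕ) : Prop := d.V i = true ∧ d.τ i = zeroStr (d.m i)
/-- the `j`-th pair describes an initial segment of the stage `s` approximation -/
def Live (s j : ℕ) : Prop := d.V j = true ∧ d.τ j = d.AS s (d.m j)

end CData

/-- marker `v` is alive at the beginning of stage `s` -/
def In (p : ℕ → ℕ) (v s : ℕ) : Prop := v < s ∧ ∀ x < s, v < x → p v < p x
/-- `t` lies between marker `v` and the previous marker -/
def Reg (p : ℕ → ℕ) (v t : ℕ) : Prop := t ≤ v ∧ ∀ x < v, In p x (v + 1) → x < t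
/-- marker `v` is hit at stage `s` -/
def Hit (p : ℕ → ℕ) (v s : ℕ) : Prop := In p v s ∧ p v = p s
/-- the number of markers at the beginning of stage `s` -/
def mlen (p : ℕ → ℕ) (s : ℕ) : ℕ := if s = 0 then 0 else p (s - 1) + 1

namespace CData
variable (d : CData) (p : ℕ → ℕ)

/-- item `i` was already treated for index `n` with the current version -/
def NC (i n s : ℕ) : Prop := ∃ r < s, (∃ v < r, Hit p v r ∧ Reg p v (d.m i)) ∧ p r = n ∧ i < r ∧
  d.AS r (d.m i) = d.AS s (d.m i)

/-- item `i` is a current item of marker `v` -/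
def Item (v s i : ℕ) : Prop := d.Z i ∧ Reg p v (d.m i) ∧
  (¬ ∃ j < s, d.V j = true ∧ d.τ j = d.AS s (d.m i) ∧ d.k j ≤ d.k i + 2 * p v) ∧ ¬ d.NC p i (p v) s

/-- scaled weight of the items -/
noncomputable def DN (v s : ℕ) : ℕ :=
  ∑ i ∈ Finset.range s, if d.Item p v s i then 2 ^ (s - d.k i) else 0
/-- scaled weight of the live descriptions of long strings -/
noncomputable def LN (v s : ℕ) : ℕ :=
  ∑ j ∈ Finset.range s, if d.Live s j ∧ v < d.m j then 2 ^ (s - d.k j) else 0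

/-- marker `v` should be hit at stage `s` -/
def Viol (v s : ℕ) : Prop := d.DN p v s ≤ 4 ^ (p v) * d.LN v s ∨
  (d.h s (p v) = true ∧ ¬ d.h v (p v) = true)

/-- the properties of the construction -/
structure Con : Prop where
  le : ∀ s, p s ≤ mlen p s
  nv : ∀ v s, In p v s → p v < p s → ¬ d.Viol p v s
  hit : ∀ s, p s < mlen p s → ∃ v, Hit p v s ∧ d.Viol p v s

/-- weight of a pair -/
noncomputable def w (j : ℕ) : ℝ := if d.V j = true then wt (d.k j) else 0

/-- the properties of the data -/
structure Good : Prop where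
  bk : ∀ j, d.V j = true → d.k j ≤ j
  bm : ∀ j, d.V j = true → d.m j ≤ j
  inj : ∀ i j, d.V i = true → d.V j = true → d.k i = d.k j → d.τ i = d.τ j → i = j
  sum : ∀ J : Finset ℕ, ∑ j ∈ J, d.w j ≤ 1
  am : ∀ s t i, s ≤ t → d.a s i = true → d.a t i = true
  hm : ∀ s t i, s ≤ t → d.h s i = true → d.h t i = true

end CData

/-! ### Structure of the markers -/
section markers
variable {p : ℕ → ℕ}

lemma In.mono {v s r : ℕ} (h : In p v s) (h1 : v < r) (h2 : r ≤ s) : In p v r :=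
  ⟨h1, fun x hx hv => h.2 x (hx.trans_le h2) hv⟩

lemma In.self (s : ℕ) : In p s (s + 1) := ⟨by omega, fun x _ _ => by omega⟩

lemma In.succ {v s : ℕ} (h : In p v s) (h1 : p v < p s) : In p v (s + 1) := by
  refine ⟨h.1.trans (by omega), fun x hx hv => ?_⟩
  rcases Nat.lt_succ_iff_lt_or_eq.1 hx with h2 | h2
  · exact h.2 x h2 hv
  · rw [h2]; exact h1

lemma mlen_succ (s : ℕ) : mlen p (s + 1) = p s + 1 := by simp [mlen]

lemma exists_In (hle : ∀ s, p s ≤ mlen p s) (s n : ℕ) (h : n < mlen p s) :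
    ∃ v, In p v s ∧ p v = n := by
  induction s with
  | zero => simp [mlen] at h
  | succ s ih =>
    rw [mlen_succ] at h
    rcases Nat.lt_succ_iff_lt_or_eq.1 h with h2 | h2
    · obtain ⟨v, h3, h4⟩ := ih (h2.trans_le (hle s))
      exact ⟨v, h3.succ (by omega), h4⟩
    · exact ⟨s, In.self s, h2.symm⟩

lemma In.lt_mlen {v s : ℕ} (h : In p v s) : p v < mlen p s := by
  cases s with
  | zero => exact absurd h.1 (by omega)
  | succ s =>
    rw [mlen_succ]
    rcases Nat.lt_succ_iff_lt_or_eq.1 h.1 with h2 | h2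
    · have := h.2 s (by omega) h2; omega
    · rw [h2]; omega

lemma In.lt_iff {v v' s : ℕ} (h : In p v s) (h' : In p v' s) : v < v' ↔ p v < p v' := by
  constructor
  · intro hl; exact h.2 v' h'.1 hl
  · intro hl
    by_contra hc
    rcases Nat.lt_or_eq_of_le (not_lt.1 hc) with h2 | h2
    · have := h'.2 v h.1 h2; omega
    · subst h2; omega

lemma Hit.unique {v v' s : ℕ} (h : Hit p v s) (h' : Hit p v' s) : v = v' := by
  have h1 := h.1.lt_iff h'.1
  have h2 := h'.1.lt_iff h.1
  have := h.2
  have := h'.2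
  omega

lemma Hit.lt_mlen {v s : ℕ} (h : Hit p v s) : p s < mlen p s := h.2 ▸ h.1.lt_mlen

/-- a later hit of the same index has a marker not below the earlier stage -/
lemma Hit.ge {v s r : ℕ} (h : Hit p v s) (h1 : r < s) (h2 : p r = p s) : r ≤ v := by
  by_contra hc
  have := h.1.2 r h1 (by omega)
  have := h.2
  omega

lemma exists_removal {x s r : ℕ} (h : In p x s) (h1 : ¬ In p x r) (h2 : s ≤ r) :
    ∃ q, s ≤ q ∧ q < r ∧ In p x q ∧ p q ≤ p x := by
  induction r with
  | zero =>
    have := h.1; omega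
  | succ r ih =>
    have hsr : s ≠ r + 1 := by rintro rfl; exact h1 h
    by_cases hr : In p x r
    · refine ⟨r, by omega, by omega, hr, ?_⟩
      by_contra hc
      exact h1 (hr.succ (by omega))
    · obtain ⟨q, a1, a2, a3⟩ := ih hr (by omega)
      exact ⟨q, a1, by omega, a3⟩

lemma reg_same (hle : ∀ s, p s ≤ mlen p s) {v₁ v₂ s₁ s₂ t : ℕ} (hp : p v₁ = p v₂)
    (r1 : Reg p v₁ t) (r2 : Reg p v₂ t)
    (i1 : In p v₁ s₁) (i2 : In p v₂ s₂) (hs : s₁ ≤ s₂) (x : ℕ) (hx : x < t) :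
    In p x s₁ ↔ In p x s₂ := by
  have a1 := r1.1
  have a2 := i1.1
  constructor
  · intro h
    by_contra hc
    obtain ⟨q, b1, b2, b3, b4⟩ := exists_removal h hc hs
    have c1 : p x < p v₁ := h.2 v₁ i1.1 (by omega)
    have c2 : q < v₂ := by
      by_contra hc2
      rcases Nat.lt_or_eq_of_le (not_lt.1 hc2) with c3 | c3
      · have := i2.2 q b2 c3; omega
      · subst c3; omega
    obtain ⟨y, y1, y2⟩ := exists_In hle v₂ (p q) (by have := hle v₂; omega)
    have y3 : In p y (v₂ + 1) := y1.succ (by omega)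
    have y4 := r2.2 y y1.1 y3
    have y5 : ¬ y < q := by
      intro hy
      have := y1.2 q c2 hy
      omega
    omega
  · intro h
    exact h.mono (by omega) hs

end markers

/-! ### Strings -/
section strings
variable {d : CData}

lemma AS_length (s t : ℕ) : (d.AS s t).length = t := by simp [CData.AS]

lemma map_range_eq_iff {f g : ℕ → Bool} {t : ℕ} :
    (List.range t).map f = (List.range t).map g ↔ ∀ x < t, f x = g x := by
  constructor
  · intro h x hx
    have := congrArg (fun l => l[x]?) h
    simpa [hx] using this
  · intro h
    apply List.map_congr_left
    intro x hx
    exact h x (List.mem_range.1 hx)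

lemma AS_eq_iff {s r t : ℕ} : d.AS s t = d.AS r t ↔ ∀ x < t, d.a s x = d.a r x := map_range_eq_iff

lemma AS_mono {s r t t' : ℕ} (h : d.AS s t = d.AS r t) (h1 : t' ≤ t) : d.AS s t' = d.AS r t' :=
  AS_eq_iff.2 (fun x hx => AS_eq_iff.1 h x (by omega))

lemma AS_between (hd : d.Good) {s q r t : ℕ} (h : d.AS s t = d.AS r t) (h1 : s ≤ q) (h2 : q ≤ r) :
    d.AS s t = d.AS q t := by
  refine AS_eq_iff.2 (fun x hx => ?_)
  have h3 := AS_eq_iff.1 h x hx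
  have h4 := hd.am s q x h1
  have h5 := hd.am q r x h2
  cases hs : d.a s x <;> cases hq : d.a q x <;> simp_all

lemma live_between (hd : d.Good) {s q r j : ℕ} (h : d.Live s j) (h' : d.Live r j)
    (h1 : s ≤ q) (h2 : q ≤ r) : d.Live q j := by
  refine ⟨h.1, ?_⟩
  rw [← AS_between hd (h.2.symm.trans h'.2) h1 h2]
  exact h.2

lemma live_AS {s r j : ℕ} (h : d.Live s j) (h' : d.Live r j) : d.AS s (d.m j) = d.AS r (d.m j) :=
  h.2.symm.trans h'.2

lemma w_nonneg (j : ℕ) : 0 ≤ d.w j := by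
  unfold CData.w; split_ifs; exacts [wt_nonneg _, le_rfl]

lemma w_of {j : ℕ} (h : d.V j = true) : d.w j = wt (d.k j) := by simp [CData.w, h]
end strings
end part4

section part5
/-! ### Generic counting lemmas -/

/-- greedy charging -/
lemma greedy (w : ℕ → ℝ) (hw : ∀ j, 0 ≤ w j) (J : Finset ℕ) (H : ℕ → Finset ℕ) (d E : ℕ → ℝ)
    (hd0 : ∀ s, 0 ≤ d s) (hE0 : ∀ s, 0 ≤ E s) (T : Finset ℕ)
    (hH : ∀ s ∈ T, H s ⊆ J) (hd : ∀ s ∈ T, d s ≤ ∑ j ∈ H s, w j)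
    (hE : ∀ s ∈ T, ∑ r ∈ T.filter (fun r => r < s ∧ (H r ∩ H s).Nonempty), d r ≤ E s) :
    ∑ s ∈ T, d s ≤ ∑ j ∈ J, w j + ∑ s ∈ T, E s := by
  have main : ∃ r : ℕ → ℝ, (∀ j, 0 ≤ r j ∧ r j ≤ w j) ∧
      (∑ s ∈ T, (d s - E s) ≤ ∑ j ∈ J, (w j - r j)) ∧
      ∀ F : Finset ℕ, ∑ j ∈ F, (w j - r j) ≤
        ∑ s ∈ T.filter (fun s => (H s ∩ F).Nonempty), d s := by
    induction T using Finset.induction_on_max with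
    | empty => exact ⟨w, fun j => ⟨hw j, le_rfl⟩, by simp, by simp⟩
    | insert s T hs ih =>
      have hsT : s ∉ T := fun h => lt_irrefl _ (hs s h)
      obtain ⟨r, r1, r2, r3⟩ := ih (fun x hx => hH x (by simp [hx])) (fun x hx => hd x (by simp [hx]))
        (by
          intro x hx
          refine le_trans ?_ (hE x (by simp [hx]))
          refine Finset.sum_le_sum_of_subset_of_nonneg ?_ (fun _ _ _ => hd0 _)
          exact Finset.filter_subset_filter _ (Finset.subset_insert _ _))
      set c := max (d s - E s) 0 with hc
      set R := ∑ j ∈ H s, r j with hR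
      have hR0 : 0 ≤ R := Finset.sum_nonneg (fun j _ => (r1 j).1)
      have hc0 : 0 ≤ c := le_max_right _ _
      have hcd : c ≤ d s := max_le (by linarith [hE0 s]) (hd0 s)
      have hcR : c ≤ R := by
        refine max_le ?_ hR0
        have a1 := r3 (H s)
        rw [Finset.sum_sub_distrib] at a1
        have a2 := hd s (by simp)
        have a3 := hE s (by simp)
        have a4 : (insert s T).filter (fun r => r < s ∧ (H r ∩ H s).Nonempty) =
            T.filter (fun r => (H r ∩ H s).Nonempty) := by
          ext x
          simp only [Finset.mem_filter, Finset.mem_insert]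
          constructor
          · rintro ⟨h1 | h1, h2, h3⟩
            · omega
            · exact ⟨h1, h3⟩
          · rintro ⟨h1, h2⟩
            exact ⟨Or.inr h1, hs x h1, h2⟩
        rw [a4] at a3
        linarith
      have hfrac : 0 ≤ c / R ∧ c / R ≤ 1 :=
        ⟨div_nonneg hc0 hR0, div_le_one_of_le₀ hcR hR0⟩
      have hmul : c / R * R = c := by
        by_cases h0 : R = 0
        · have : c = 0 := le_antisymm (h0 ▸ hcR) hc0
          rw [this]; simp
        · field_simp
      refine ⟨fun j => if j ∈ H s then r j - c / R * r j else r j, ?_, ?_, ?_⟩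
      · intro j
        have := r1 j
        by_cases hj : j ∈ H s
        · simp only [if_pos hj]
          constructor
          · nlinarith
          · nlinarith
        · simp only [if_neg hj]; exact this
      · rw [Finset.sum_insert hsT]
        have : ∑ j ∈ J, (w j - if j ∈ H s then r j - c / R * r j else r j) =
            ∑ j ∈ J, (w j - r j) + c := by
          have h1 : ∀ j ∈ J, (w j - if j ∈ H s then r j - c / R * r j else r j) =
              (w j - r j) + if j ∈ H s then c / R * r j else 0 := by
            intro j _; split_ifs <;> ring
          rw [Finset.sum_congr rfl h1, Finset.sum_add_distrib, ← Finset.sum_filter,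
            Finset.filter_mem_eq_inter, Finset.inter_eq_right.2 (hH s (by simp)), ← Finset.mul_sum,
            hmul]
        rw [this]
        have := le_max_left (d s - E s) 0
        linarith
      · intro F
        have h2 : ∑ j ∈ F, (w j - if j ∈ H s then r j - c / R * r j else r j) =
            ∑ j ∈ F, (w j - r j) + c / R * ∑ j ∈ F ∩ H s, r j := by
          have h1 : ∀ j ∈ F, (w j - if j ∈ H s then r j - c / R * r j else r j) =
              (w j - r j) + if j ∈ H s then c / R * r j else 0 := by
            intro j _; split_ifs <;> ring
          rw [Finset.sum_congr rfl h1, Finset.sum_add_distrib, ← Finset.sum_filter,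
            Finset.filter_mem_eq_inter, ← Finset.mul_sum]
        rw [h2, Finset.filter_insert]
        by_cases hne : (H s ∩ F).Nonempty
        · rw [if_pos hne, Finset.sum_insert (by simp [hsT])]
          have h3 : ∑ j ∈ F ∩ H s, r j ≤ R :=
            Finset.sum_le_sum_of_subset_of_nonneg Finset.inter_subset_right (fun j _ _ => (r1 j).1)
          have h4 := mul_le_mul_of_nonneg_left h3 hfrac.1
          have := r3 F
          linarith
        · rw [if_neg hne]
          rw [Finset.not_nonempty_iff_eq_empty, Finset.inter_comm] at hne
          rw [hne]
          simpa using r3 F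
  obtain ⟨r, r1, r2, -⟩ := main
  rw [Finset.sum_sub_distrib] at r2
  have : ∑ j ∈ J, (w j - r j) ≤ ∑ j ∈ J, w j :=
    Finset.sum_le_sum (fun j _ => by linarith [(r1 j).1])
  linarith

/-- sums of weights with injective exponents -/
lemma sum_wt_inj (F : Finset ℕ) (p : ℕ → ℕ) (b : ℕ) (hb : ∀ s ∈ F, b ≤ p s)
    (hinj : ∀ s ∈ F, ∀ r ∈ F, p s = p r → s = r) : ∑ s ∈ F, wt (p s) ≤ 2 * wt b := by
  have : ∑ s ∈ F, wt (p s) = ∑ i ∈ F.image p, wt i := by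
    rw [Finset.sum_image]
    intro x hx y hy; exact hinj x hx y hy
  rw [this]
  apply sum_wt_finset
  intro i hi
  obtain ⟨s, hs, rfl⟩ := Finset.mem_image.1 hi
  exact hb s hs

/-- bounding a set of requests through an indexing -/
lemma request_bound {ι : Type} [Nonempty ι] (P : ι → Prop) (g : ι → ℕ × Str) (c : ℝ)
    (hF : ∀ F : Finset ι, (∀ x ∈ F, P x) → (∀ x ∈ F, ∀ y ∈ F, g x = g y → x = y) →
      ∑ x ∈ F, wt (g x).1 ≤ c)
    (S : Finset (ℕ × Str)) (hS : ∀ q ∈ S, ∃ x, P x ∧ g x = q) : ∑ q ∈ S, wt q.1 ≤ c := by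
  choose! f hf using hS
  have h := hF (S.image f) (by
    intro x hx
    obtain ⟨q, hq, rfl⟩ := Finset.mem_image.1 hx
    exact (hf q hq).1) (by
    intro x hx y hy hxy
    obtain ⟨q, hq, rfl⟩ := Finset.mem_image.1 hx
    obtain ⟨q', hq', rfl⟩ := Finset.mem_image.1 hy
    rw [(hf q hq).2, (hf q' hq').2] at hxy
    rw [hxy])
  rw [Finset.sum_image] at h
  · refine le_trans (le_of_eq ?_) h
    exact Finset.sum_congr rfl (fun q hq => by rw [(hf q hq).2])
  · intro x hx y hy hxy
    rw [← (hf x hx).2, ← (hf y hy).2, hxy]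

/-- interleaving -/
lemma card_interleave (F : Finset ℕ) (T : ℕ → Prop) (N : ℕ) (hN : ∀ s ∈ F, s ≤ N)
    (h : ∀ s ∈ F, ∀ r ∈ F, s < r → ∃ t, s ≤ t ∧ t < r ∧ T t) :
    F.card ≤ 1 + ((Finset.range N).filter T).card := by
  have hmono : ∀ s ∈ F, ∀ r ∈ F, s < r →
      ((Finset.range s).filter T).card < ((Finset.range r).filter T).card := by
    intro s hs r hr hsr
    obtain ⟨t, h1, h2, h3⟩ := h s hs r hr hsr
    apply Finset.card_lt_card
    refine ⟨Finset.filter_subset_filter _ (Finset.range_mono hsr.le), fun hc => ?_⟩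
    have := hc (Finset.mem_filter.2 ⟨Finset.mem_range.2 h2, h3⟩)
    have := (Finset.mem_range.1 (Finset.mem_filter.1 this).1)
    omega
  have := Finset.card_le_card_of_injOn (s := F)
    (t := Finset.range (1 + ((Finset.range N).filter T).card))
    (fun s => ((Finset.range s).filter T).card) (by
      intro s hs
      simp only [Finset.coe_range, Set.mem_Iio]
      have : ((Finset.range s).filter T).card ≤ ((Finset.range N).filter T).card :=
        Finset.card_le_card (Finset.filter_subset_filter _ (Finset.range_mono (hN s hs)))
      omega) (by
      intro s hs r hr hsr
      simp only at hsr
      rcases lt_trichotomy s r with hl | hl | hl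
      · have := hmono s hs r hr hl; omega
      · exact hl
      · have := hmono r hr s hs hl; omega)
  simpa using this

/-! ### Real weights -/
namespace CData
variable (d : CData) (p : ℕ → ℕ)

/-- weight of the items -/
noncomputable def D (v s : ℕ) : ℝ :=
  ∑ i ∈ Finset.range s, if d.Item p v s i then d.w i * wt (2 * p v) else 0
/-- weight of the live descriptions of long strings -/
noncomputable def L (v s : ℕ) : ℝ :=
  ∑ j ∈ Finset.range s, if d.Live s j ∧ v < d.m j then d.w j else 0

/-- the marker hit at stage `s` -/
noncomputable def vv (s : ℕ) : ℕ := if h : ∃ v, Hit p v s then h.choose else 0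

/-- some marker is hit -/
def IsHit (s : ℕ) : Prop := ∃ v, Hit p v s

/-- cost of the hit at `s` -/
noncomputable def ds (s : ℕ) : ℝ := d.D p (vv p s) s
end CData
open CData

variable {d : CData} {p : ℕ → ℕ}

lemma wt_two_mul (n : ℕ) : wt (2 * n) * 4 ^ n = 1 := by
  unfold wt
  rw [pow_mul, ← mul_pow]; norm_num

lemma D_eq (v s : ℕ) : d.D p v s =
    (∑ i ∈ Finset.range s, if d.Item p v s i then d.w i else 0) * wt (2 * p v) := by
  unfold CData.D
  rw [Finset.sum_mul]
  refine Finset.sum_congr rfl (fun i _ => ?_)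
  split_ifs <;> simp

lemma thr_iff (hd : d.Good) (v s : ℕ) :
    d.DN p v s ≤ 4 ^ (p v) * d.LN v s ↔ d.D p v s ≤ d.L v s := by
  have h1 : (d.DN p v s : ℝ) =
      (∑ i ∈ Finset.range s, if d.Item p v s i then d.w i else 0) * 2 ^ s := by
    unfold CData.DN
    rw [Finset.sum_mul]
    push_cast
    refine Finset.sum_congr rfl (fun i hi => ?_)
    split_ifs with h
    · rw [w_of h.1.1, wt_scale ((hd.bk i h.1.1).trans (Finset.mem_range.1 hi).le)]
    · simp
  have h2 : (d.LN v s : ℝ) = d.L v s * 2 ^ s := by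
    unfold CData.LN CData.L
    rw [Finset.sum_mul]
    push_cast
    refine Finset.sum_congr rfl (fun i hi => ?_)
    split_ifs with h
    · rw [w_of h.1.1, wt_scale ((hd.bk i h.1.1).trans (Finset.mem_range.1 hi).le)]
    · simp
  have h3 := wt_two_mul (p v)
  have h4 := wt_pos (2 * p v)
  have h5 : (0 : ℝ) < 2 ^ s := by positivity
  have h6 : (0 : ℝ) < 4 ^ (p v) := by positivity
  rw [D_eq]
  set X := ∑ i ∈ Finset.range s, if d.Item p v s i then d.w i else 0
  have h7 : (d.DN p v s ≤ 4 ^ (p v) * d.LN v s) ↔ X * 2 ^ s ≤ 4 ^ (p v) * (d.L v s * 2 ^ s) := by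
    rw [← h1, ← h2]; exact_mod_cast Iff.rfl
  rw [h7, ← mul_assoc, mul_le_mul_iff_left₀ h5]
  rw [← mul_le_mul_iff_left₀ h4]
  rw [show 4 ^ p v * d.L v s * wt (2 * p v) = d.L v s * (wt (2 * p v) * 4 ^ p v) by ring, h3, mul_one]

lemma D_nonneg (v s : ℕ) : 0 ≤ d.D p v s := by
  unfold CData.D
  refine Finset.sum_nonneg (fun i _ => ?_)
  split_ifs
  · exact mul_nonneg (w_nonneg _) (wt_nonneg _)
  · exact le_rfl

lemma L_nonneg (v s : ℕ) : 0 ≤ d.L v s := by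
  unfold CData.L
  refine Finset.sum_nonneg (fun i _ => ?_)
  split_ifs
  · exact w_nonneg _
  · exact le_rfl

lemma D_le (hd : d.Good) (v s : ℕ) : d.D p v s ≤ wt (2 * p v) := by
  rw [D_eq]
  have : (∑ i ∈ Finset.range s, if d.Item p v s i then d.w i else 0) ≤ 1 := by
    refine le_trans (Finset.sum_le_sum (fun i _ => ?_)) (hd.sum (Finset.range s))
    split_ifs
    · exact le_rfl
    · exact w_nonneg _
  have := mul_le_mul_of_nonneg_right this (wt_nonneg (2 * p v))
  linarith

lemma ds_nonneg (s : ℕ) : 0 ≤ d.ds p s := D_nonneg _ _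

lemma vv_hit {s : ℕ} (h : IsHit p s) : Hit p (vv p s) s := by
  unfold IsHit at h
  unfold CData.vv
  rw [dif_pos h]; exact h.choose_spec

lemma vv_eq {s v : ℕ} (h : Hit p v s) : vv p s = v := (vv_hit ⟨v, h⟩).unique h

lemma hit_viol (hc : d.Con p) {s : ℕ} (h : IsHit p s) : d.Viol p (vv p s) s := by
  obtain ⟨v, h1, h2⟩ := hc.hit s (vv_hit h).lt_mlen
  rw [vv_eq h1]; exact h2

lemma isHit_iff (hc : d.Con p) {s : ℕ} : IsHit p s ↔ p s < mlen p s := by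
  constructor
  · rintro ⟨v, h⟩; exact h.lt_mlen
  · intro h
    obtain ⟨v, h1, -⟩ := hc.hit s h
    exact ⟨v, h1⟩

lemma accept_iff (hc : d.Con p) {s : ℕ} : ¬ IsHit p s ↔ p s = mlen p s := by
  rw [isHit_iff hc]
  have := hc.le s
  omega

lemma pv {s : ℕ} (h : IsHit p s) : p (vv p s) = p s := (vv_hit h).2
end part5

section part6
open CData
variable {d : CData} {p : ℕ → ℕ}

lemma sum_range_ext (f : ℕ → ℝ) {s N : ℕ} (h : s ≤ N) :
    ∑ i ∈ Finset.range s, f i = ∑ i ∈ Finset.range N, if i < s then f i else 0 := by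
  rw [← Finset.sum_filter]
  congr 1
  ext i
  simp only [Finset.mem_range, Finset.mem_filter]
  omega

lemma double_count (F : Finset ℕ) (N : ℕ) (w : ℕ → ℝ) (hw : ∀ i, 0 ≤ w i) (R : ℕ → ℕ → Prop)
    [∀ s i, Decidable (R s i)] [∀ i, Decidable (∃ s ∈ F, R s i)]
    (q : ℕ → ℕ) (b : ℕ) (hb : ∀ i, ∀ s ∈ F, R s i → b ≤ q s)
    (hinj : ∀ i, ∀ s ∈ F, ∀ r ∈ F, R s i → R r i → q s = q r → s = r) :
    ∑ s ∈ F, ∑ i ∈ Finset.range N, (if R s i then w i * wt (q s) else 0) ≤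
      ∑ i ∈ Finset.range N, if ∃ s ∈ F, R s i then 2 * wt b * w i else 0 := by
  rw [Finset.sum_comm]
  refine Finset.sum_le_sum (fun i _ => ?_)
  split_ifs with h
  · rw [← Finset.sum_filter, ← Finset.mul_sum]
    have := sum_wt_inj (F.filter (fun s => R s i)) q b
      (fun s hs => hb i s (Finset.mem_filter.1 hs).1 (Finset.mem_filter.1 hs).2)
      (fun s hs r hr => hinj i s (Finset.mem_filter.1 hs).1 r (Finset.mem_filter.1 hr).1
        (Finset.mem_filter.1 hs).2 (Finset.mem_filter.1 hr).2)
    have := mul_le_mul_of_nonneg_left this (hw i)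
    linarith
  · push Not at h
    apply le_of_eq
    refine Finset.sum_eq_zero (fun s hs => ?_)
    rw [if_neg (h s hs)]

lemma vv_lt {s : ℕ} (h : IsHit p s) : vv p s < s := (vv_hit h).1.1

/-- distinct hits with the same live long description -/
lemma hit_pair (hd : d.Good) {r s j : ℕ} (hr : IsHit p r) (hs : IsHit p s) (hrs : r < s)
    (hjr : j < r) (l1 : d.Live r j) (l2 : d.Live s j) (h1 : vv p r < d.m j) (h2 : vv p s < d.m j) :
    p s < p r ∧ vv p s < vv p r ∧ ∀ t, t ≤ vv p r → d.AS r t = d.AS s t := by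
  have hm := hd.bm j l1.1
  have a1 : p (vv p s) < p r := (vv_hit hs).1.2 r hrs (by omega)
  rw [pv hs] at a1
  have a2 : In p (vv p s) r := (vv_hit hs).1.mono (by omega) hrs.le
  refine ⟨a1, ?_, ?_⟩
  · rw [a2.lt_iff (vv_hit hr).1, pv hs, pv hr]; exact a1
  · intro t ht
    exact AS_mono (live_AS l1 l2) (by omega)

lemma ds_range {s N : ℕ} (hs : IsHit p s) (h : s ≤ N) : d.ds p s = ∑ i ∈ Finset.range N,
    if i < s ∧ d.Item p (vv p s) s i then d.w i * wt (2 * p s) else 0 := by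
  unfold CData.ds CData.D
  rw [sum_range_ext _ h]
  refine Finset.sum_congr rfl (fun i _ => ?_)
  rw [pv hs]
  split_ifs <;> first | rfl | tauto

lemma thr_sum (hd : d.Good) (T : Finset ℕ) (hT : ∀ s ∈ T, IsHit p s)
    (hL : ∀ s ∈ T, d.D p (vv p s) s ≤ d.L (vv p s) s) : ∑ s ∈ T, d.ds p s ≤ 3 := by
  obtain ⟨N, hN⟩ : ∃ N, ∀ s ∈ T, s ≤ N := ⟨T.sup id, fun s hs => Finset.le_sup (f := id) hs⟩
  have key := greedy d.w w_nonneg (Finset.range N)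
    (fun s => (Finset.range s).filter (fun j => d.Live s j ∧ vv p s < d.m j))
    (d.ds p) (fun s => ∑ i ∈ Finset.range N,
      if i < s ∧ vv p s < d.m i ∧ d.m i < s then d.w i * wt (2 * p s) else 0)
    ds_nonneg (fun s => Finset.sum_nonneg (fun i _ => by
      split_ifs
      · exact mul_nonneg (w_nonneg _) (wt_nonneg _)
      · exact le_rfl)) T
    (fun s hs => (Finset.filter_subset _ _).trans (Finset.range_mono (hN s hs)))
    (fun s hs => by
      refine (hL s hs).trans (le_of_eq ?_)
      unfold CData.L
      rw [Finset.sum_filter]) ?_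
  · have h1 := hd.sum (Finset.range N)
    have h2 := double_count T N d.w w_nonneg (fun s i => i < s ∧ vv p s < d.m i ∧ d.m i < s)
      (fun s => 2 * p s) 0 (fun _ _ _ _ => Nat.zero_le _) (by
        have aux : ∀ i, ∀ s ∈ T, ∀ r ∈ T, (i < s ∧ vv p s < d.m i ∧ d.m i < s) →
            (i < r ∧ vv p r < d.m i ∧ d.m i < r) → 2 * p s = 2 * p r → ¬ r < s := by
          intro i s hs r hr h1 h2 h3 h4
          have := (vv_hit (hT s hs)).ge h4 (by omega)
          omega
        intro i s hs r hr h1 h2 h3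
        have a1 := aux i s hs r hr h1 h2 h3
        have a2 := aux i r hr s hs h2 h1 h3.symm
        omega)
    have h3 : (∑ i ∈ Finset.range N, if ∃ s ∈ T, (i < s ∧ vv p s < d.m i ∧ d.m i < s) then
        2 * wt 0 * d.w i else 0) ≤ 2 * ∑ i ∈ Finset.range N, d.w i := by
      rw [Finset.mul_sum]
      refine Finset.sum_le_sum (fun i _ => ?_)
      rw [wt_zero]
      have := w_nonneg (d := d) i
      split_ifs <;> linarith
    linarith
  · intro s hs
    set F := T.filter (fun r => r < s ∧ (((Finset.range r).filter
      (fun j => d.Live r j ∧ vv p r < d.m j)) ∩ ((Finset.range s).filter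
      (fun j => d.Live s j ∧ vv p s < d.m j))).Nonempty) with hF
    have hFm : ∀ r ∈ F, IsHit p r ∧ r ≤ N ∧ r < s ∧
        p s < p r ∧ vv p s < vv p r ∧ ∀ t, t ≤ vv p r → d.AS r t = d.AS s t := by
      intro r hr
      obtain ⟨h1, h2, j, hj⟩ := Finset.mem_filter.1 hr
      simp only [Finset.mem_inter, Finset.mem_filter, Finset.mem_range] at hj
      exact ⟨hT r h1, hN r h1, h2, hit_pair hd (hT r h1) (hT s hs) h2 hj.1.1 hj.1.2.1 hj.2.2.1
        hj.1.2.2 hj.2.2.2⟩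
    have e1 : ∑ r ∈ F, d.ds p r = ∑ r ∈ F, ∑ i ∈ Finset.range N,
        if i < r ∧ d.Item p (vv p r) r i then d.w i * wt (2 * p r) else 0 :=
      Finset.sum_congr rfl (fun r hr => ds_range (hFm r hr).1 (hFm r hr).2.1)
    rw [e1]
    refine (double_count F N d.w w_nonneg (fun r i => i < r ∧ d.Item p (vv p r) r i)
      (fun r => 2 * p r) (2 * p s + 2) ?_ ?_).trans ?_
    · intro i r hr _
      have := (hFm r hr).2.2.2.1
      omega
    · have aux : ∀ i, ∀ r ∈ F, ∀ q ∈ F, (i < r ∧ d.Item p (vv p r) r i) →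
          (i < q ∧ d.Item p (vv p q) q i) → 2 * p r = 2 * p q → ¬ q < r := by
        intro i r hr q hq h1 h2 h3 h4
        apply h1.2.2.2.2
        have b1 := hFm r hr
        have b2 := hFm q hq
        refine ⟨q, h4, ⟨vv p q, vv_lt b2.1, vv_hit b2.1, h2.2.2.1⟩, ?_, h2.1, ?_⟩
        · rw [pv b1.1]; omega
        · rw [b1.2.2.2.2.2 _ h1.2.2.1.1, b2.2.2.2.2.2 _ h2.2.2.1.1]
      intro i r hr q hq h1 h2 h3
      have a1 := aux i r hr q hq h1 h2 h3
      have a2 := aux i q hq r hr h2 h1 h3.symm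
      omega
    · refine Finset.sum_le_sum (fun i _ => ?_)
      have hwi := w_nonneg (d := d) i
      have hwp := wt_nonneg (2 * p s)
      by_cases hex : ∃ r ∈ F, i < r ∧ d.Item p (vv p r) r i
      · obtain ⟨r, hr, h1, h2⟩ := hex
        have b1 := hFm r hr
        have b2 : vv p s < d.m i := by
          apply h2.2.1.2 _ b1.2.2.2.2.1
          have := vv_lt b1.1
          exact (vv_hit (hT s hs)).1.mono (by omega) (by omega)
        have b3 := h2.2.1.1
        have b4 := vv_lt b1.1
        rw [if_pos ⟨r, hr, h1, h2⟩, if_pos ⟨by omega, b2, by omega⟩]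
        rw [wt_succ, wt_succ]
        nlinarith [mul_nonneg hwi hwp]
      · rw [if_neg hex]
        split_ifs
        · positivity
        · exact le_rfl

lemma code_sum (hd : d.Good) (T : Finset ℕ) (hT : ∀ s ∈ T, IsHit p s)
    (hL : ∀ s ∈ T, d.h s (p s) = true ∧ ¬ d.h (vv p s) (p s) = true) :
    ∑ s ∈ T, d.ds p s ≤ 2 := by
  have h1 : ∑ s ∈ T, d.ds p s ≤ ∑ s ∈ T, wt (2 * p s) := by
    refine Finset.sum_le_sum (fun s hs => ?_)
    have := D_le (p := p) hd (vv p s) s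
    rw [pv (hT s hs)] at this
    exact this
  have h2 := sum_wt_inj T (fun s => 2 * p s) 0 (fun _ _ => Nat.zero_le _) (by
    have aux : ∀ s ∈ T, ∀ r ∈ T, 2 * p s = 2 * p r → ¬ r < s := by
      intro s hs r hr h h4
      have := (vv_hit (hT s hs)).ge h4 (by omega)
      apply (hL s hs).2
      have h5 : p s = p r := by omega
      rw [h5]
      exact hd.hm r _ _ this (hL r hr).1
    intro s hs r hr h
    have a1 := aux s hs r hr h
    have a2 := aux r hr s hs h.symm
    omega)
  rw [wt_zero] at h2
  linarith

lemma hit_sum (hd : d.Good) (hc : d.Con p) (T : Finset ℕ) (hT : ∀ s ∈ T, IsHit p s) :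
    ∑ s ∈ T, d.ds p s ≤ 5 := by
  rw [← Finset.sum_filter_add_sum_filter_not T (fun s => d.D p (vv p s) s ≤ d.L (vv p s) s)]
  have h1 := thr_sum hd (T.filter (fun s => d.D p (vv p s) s ≤ d.L (vv p s) s))
    (fun s hs => hT s (Finset.mem_filter.1 hs).1) (fun s hs => (Finset.mem_filter.1 hs).2)
  have h2 := code_sum hd (T.filter (fun s => ¬ d.D p (vv p s) s ≤ d.L (vv p s) s))
    (fun s hs => hT s (Finset.mem_filter.1 hs).1) (fun s hs => by
      obtain ⟨a1, a2⟩ := Finset.mem_filter.1 hs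
      rcases hit_viol hc (hT s a1) with h | h
      · exact absurd ((thr_iff hd _ _).1 h) a2
      · rw [pv (hT s a1)] at h; exact h)
  linarith

/-- requests for the strings of the given set at hits -/
lemma RN_bound (hd : d.Good) (hc : d.Con p) (S : Finset (ℕ × Str))
    (hS : ∀ q ∈ S, ∃ x : ℕ × ℕ, (IsHit p x.1 ∧ x.2 < x.1 ∧ d.Item p (vv p x.1) x.1 x.2) ∧
      (d.k x.2 + 2 * p x.1, d.AS x.1 (d.m x.2)) = q) : ∑ q ∈ S, wt q.1 ≤ 5 := by
  refine request_bound (fun x : ℕ × ℕ => IsHit p x.1 ∧ x.2 < x.1 ∧ d.Item p (vv p x.1) x.1 x.2)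
    (fun x => (d.k x.2 + 2 * p x.1, d.AS x.1 (d.m x.2))) 5 ?_ S hS
  intro F hF _
  have h1 : ∑ s ∈ F.image Prod.fst, d.ds p s ≤ 5 := by
    apply hit_sum hd hc
    intro s hs
    obtain ⟨x, hx, rfl⟩ := Finset.mem_image.1 hs
    exact (hF x hx).1
  refine le_trans ?_ h1
  rw [← Finset.sum_fiberwise_of_maps_to (t := F.image Prod.fst) (g := Prod.fst)
    (fun x hx => Finset.mem_image_of_mem _ hx)]
  refine Finset.sum_le_sum (fun s hs => ?_)
  obtain ⟨x0, hx0, rfl⟩ := Finset.mem_image.1 hs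
  set s := x0.1 with hs'
  have hh : IsHit p s := (hF x0 hx0).1
  have h2 : ∑ x ∈ F.filter (fun x => x.1 = s), wt (d.k x.2 + 2 * p x.1) =
      ∑ i ∈ (F.filter (fun x => x.1 = s)).image Prod.snd, wt (d.k i + 2 * p s) := by
    rw [Finset.sum_image]
    · exact Finset.sum_congr rfl (fun x hx => by rw [(Finset.mem_filter.1 hx).2])
    · intro x hx y hy hxy
      have a1 := (Finset.mem_filter.1 hx).2
      have a2 := (Finset.mem_filter.1 hy).2
      exact Prod.ext (a1.trans a2.symm) hxy
  change ∑ x ∈ F.filter (fun x => x.1 = s), wt (d.k x.2 + 2 * p x.1) ≤ _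
  rw [h2]
  unfold CData.ds CData.D
  rw [← Finset.sum_filter, pv hh]
  have h3 : ∀ i ∈ (F.filter (fun x => x.1 = s)).image Prod.snd,
      i < s ∧ d.Item p (vv p s) s i := by
    intro i hi
    obtain ⟨x, hx, rfl⟩ := Finset.mem_image.1 hi
    obtain ⟨a1, a2⟩ := Finset.mem_filter.1 hx
    have := hF x a1
    rw [a2] at this
    exact this.2
  refine le_trans (le_of_eq ?_) (Finset.sum_le_sum_of_subset_of_nonneg
    (s := (F.filter (fun x => x.1 = s)).image Prod.snd) ?_ ?_)
  · refine Finset.sum_congr rfl (fun i hi => ?_)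
    rw [wt_add, w_of (h3 i hi).2.1.1]
  · intro i hi
    exact Finset.mem_filter.2 ⟨Finset.mem_range.2 (h3 i hi).1, (h3 i hi).2⟩
  · intro i _ _
    exact mul_nonneg (w_nonneg _) (wt_nonneg _)

/-- the stage `s` approximation of the constructed set -/
noncomputable def BS (p : ℕ → ℕ) (s t : ℕ) : Str :=
  (List.range t).map (fun x => decide (¬ In p x s))

/-- the descriptions to be renewed after the hit at `s` -/
def QQ (d : CData) (p : ℕ → ℕ) (s j : ℕ) : Prop := IsHit p s ∧ vv p s < d.m j ∧ d.Live s j ∧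
  ∃ r ≤ s, ¬ IsHit p r ∧ j < r ∧ d.Live r j

lemma QQ_sum (hd : d.Good) (hc : d.Con p) {s N : ℕ} (hs : IsHit p s) :
    ∑ j ∈ (Finset.range N).filter (fun j => QQ d p s j), d.w j ≤ d.ds p s + 2 * d.w (s - 1) := by
  by_cases hne : ∃ j, QQ d p s j
  swap
  · push Not at hne
    rw [Finset.filter_false_of_mem (fun j _ => hne j)]
    have := ds_nonneg (d := d) (p := p) s
    have := w_nonneg (d := d) (s - 1)
    simp only [Finset.sum_empty]
    linarith
  obtain ⟨j0, -, hv0, hl0, r0, hr0, hn0, hj0, hl0'⟩ := hne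
  have hm0 := hd.bm j0 hl0.1
  have hrs : r0 ≠ s := by rintro rfl; exact hn0 hs
  obtain ⟨u, rfl⟩ : ∃ u, s = u + 1 := ⟨s - 1, by omega⟩
  rw [Nat.add_sub_cancel]
  set v := vv p (u + 1) with hv
  have hvI : In p v (u + 1) := (vv_hit hs).1
  have hvu : v < u := by omega
  have hvIu : In p v u := hvI.mono hvu (by omega)
  have hpu : p v < p u := hvI.2 u (by omega) hvu
  have hnv := hc.nv v u hvIu hpu
  have hLD : d.L v u < d.D p v u := by
    by_contra hcon
    exact hnv (Or.inl ((thr_iff hd _ _).2 (not_lt.1 hcon)))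
  have h1 : ∑ j ∈ (Finset.range N).filter (fun j => QQ d p (u + 1) j), d.w j ≤ d.L v u := by
    unfold CData.L
    rw [← Finset.sum_filter]
    refine Finset.sum_le_sum_of_subset_of_nonneg ?_ (fun _ _ _ => w_nonneg _)
    intro j hj
    obtain ⟨-, -, b1, b2, r, b3, b4, b5, b6⟩ := Finset.mem_filter.1 hj
    have hr : r ≠ u + 1 := by rintro rfl; exact b4 hs
    exact Finset.mem_filter.2 ⟨Finset.mem_range.2 (by omega),
      live_between hd b6 b2 (by omega) (by omega), b1⟩
  have hAS : ∀ t, t ≤ v → d.AS u t = d.AS (u + 1) t := by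
    intro t ht
    have := live_between hd hl0' hl0 (show r0 ≤ u by omega) (by omega)
    exact AS_mono (live_AS this hl0) (by omega)
  -- lost items
  have hlost : ∀ i, i < u → d.Item p v u i → ¬ d.Item p v (u + 1) i →
      d.V u = true ∧ d.m i = d.m u ∧ d.k u ≤ d.k i + 2 * p v := by
    intro i hi h2 h3
    by_contra hcon
    apply h3
    refine ⟨h2.1, h2.2.1, ?_, ?_⟩
    · rintro ⟨j, j1, j2, j3, j4⟩
      rcases Nat.lt_succ_iff_lt_or_eq.1 j1 with h | h
      · apply h2.2.2.1
        exact ⟨j, h, j2, by rw [hAS _ h2.2.1.1]; exact j3, j4⟩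
      · subst h
        apply hcon
        refine ⟨j2, ?_, j4⟩
        have := congrArg List.length j3
        rw [AS_length] at this
        exact this.symm
    · rintro ⟨r, r1, r2, r3, r4, r5⟩
      rcases Nat.lt_succ_iff_lt_or_eq.1 r1 with h | h
      · apply h2.2.2.2
        exact ⟨r, h, r2, r3, r4, by rw [hAS _ h2.2.1.1]; exact r5⟩
      · subst h; omega
  have h2 : d.D p v u ≤ d.D p v (u + 1) + 2 * d.w u := by
    have e1 : d.D p v u = ∑ i ∈ (Finset.range u).filter (fun i => d.Item p v u i),
        d.w i * wt (2 * p v) := by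
      unfold CData.D; rw [Finset.sum_filter]
    rw [e1, ← Finset.sum_filter_add_sum_filter_not _ (fun i => d.Item p v (u + 1) i)]
    apply add_le_add
    · unfold CData.D
      rw [← Finset.sum_filter]
      refine Finset.sum_le_sum_of_subset_of_nonneg ?_
        (fun _ _ _ => mul_nonneg (w_nonneg _) (wt_nonneg _))
      intro i hi
      simp only [Finset.mem_filter, Finset.mem_range] at hi ⊢
      exact ⟨by omega, hi.2⟩
    · set F := ((Finset.range u).filter (fun i => d.Item p v u i)).filter
        (fun i => ¬ d.Item p v (u + 1) i) with hF
      have hFm : ∀ i ∈ F, d.Item p v u i ∧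
          d.V u = true ∧ d.m i = d.m u ∧ d.k u ≤ d.k i + 2 * p v := by
        intro i hi
        simp only [hF, Finset.mem_filter, Finset.mem_range] at hi
        exact ⟨hi.1.2, hlost i hi.1.1 hi.1.2 hi.2⟩
      by_cases hVu : d.V u = true
      · rw [w_of hVu]
        refine le_trans (le_of_eq ?_) (sum_wt_inj F (fun i => d.k i + 2 * p v) (d.k u)
          (fun i hi => (hFm i hi).2.2.2) ?_)
        · refine Finset.sum_congr rfl (fun i hi => ?_)
          rw [wt_add, w_of (hFm i hi).1.1.1]
        · intro i hi j hj hij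
          have b1 := hFm i hi
          have b2 := hFm j hj
          refine hd.inj i j b1.1.1.1 b2.1.1.1 (by simpa using hij) ?_
          rw [b1.1.1.2, b2.1.1.2, b1.2.2.1, b2.2.2.1]
      · have : F = ∅ := by
          rw [Finset.eq_empty_iff_forall_notMem]
          intro i hi
          exact hVu (hFm i hi).2.1
        rw [this]
        have := w_nonneg (d := d) u
        simp only [Finset.sum_empty]
        linarith
  have : d.ds p (u + 1) = d.D p v (u + 1) := rfl
  linarith

/-- requests for the constructed set -/
lemma RM_bound (hd : d.Good) (hc : d.Con p) (S : Finset (ℕ × Str))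
    (hS : ∀ q ∈ S, ∃ x : ℕ × ℕ, (¬ IsHit p x.1 ∧ x.2 < x.1 ∧ d.Live x.1 x.2) ∧
      (d.k x.2, BS p x.1 (d.m x.2)) = q) : ∑ q ∈ S, wt q.1 ≤ 8 := by
  refine request_bound (fun x : ℕ × ℕ => ¬ IsHit p x.1 ∧ x.2 < x.1 ∧ d.Live x.1 x.2)
    (fun x => (d.k x.2, BS p x.1 (d.m x.2))) 8 ?_ S hS
  intro F hF hinj
  obtain ⟨N, hN⟩ : ∃ N, ∀ x ∈ F, x.1 ≤ N :=
    ⟨F.sup Prod.fst, fun x hx => Finset.le_sup (f := Prod.fst) hx⟩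
  have hcard : ∀ j, (F.filter (fun x => x.2 = j)).card ≤
      1 + ((Finset.range N).filter (fun s => QQ d p s j)).card := by
    intro j
    have e1 : (F.filter (fun x => x.2 = j)).card = ((F.filter (fun x => x.2 = j)).image Prod.fst).card := by
      rw [Finset.card_image_of_injOn]
      intro x hx y hy hxy
      have a1 := (Finset.mem_filter.1 hx).2
      have a2 := (Finset.mem_filter.1 hy).2
      exact Prod.ext hxy (a1.trans a2.symm)
    rw [e1]
    have hm : ∀ s ∈ (F.filter (fun x => x.2 = j)).image Prod.fst, (s, j) ∈ F := by
      intro s hs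
      obtain ⟨x, hx, rfl⟩ := Finset.mem_image.1 hs
      obtain ⟨a1, rfl⟩ := Finset.mem_filter.1 hx
      exact a1
    refine card_interleave _ (fun s => QQ d p s j) N (fun s hs => hN _ (hm s hs)) ?_
    intro s hs r hr hsr
    have s1 := hm s hs
    have r1 := hm r hr
    obtain ⟨s2, s3, s4⟩ := hF _ s1
    obtain ⟨r2, r3, r4⟩ := hF _ r1
    simp only at s2 s3 s4 r2 r3 r4
    have hmj := hd.bm j s4.1
    have hne : BS p s (d.m j) ≠ BS p r (d.m j) := by
      intro h
      have := hinj _ s1 _ r1 (by simp only [h])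
      rw [Prod.mk.injEq] at this
      omega
    have hx : ∃ x < d.m j, ¬ (decide (¬ In p x s) = decide (¬ In p x r)) := by
      by_contra hcon
      push Not at hcon
      exact hne (map_range_eq_iff.2 hcon)
    obtain ⟨x, hx1, hx2⟩ := hx
    have hx3 : In p x r → In p x s := fun h => h.mono (by omega) hsr.le
    have hx4 : In p x s ∧ ¬ In p x r := by
      by_cases h1 : In p x s <;> by_cases h2 : In p x r <;> simp_all
    obtain ⟨q, q1, q2, q3, q4⟩ := exists_removal hx4.1 hx4.2 hsr.le
    have hq : IsHit p q := (isHit_iff hc).2 (lt_of_le_of_lt q4 q3.lt_mlen)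
    have hvq : vv p q ≤ x := by
      by_contra hcon
      have := (q3.lt_iff (vv_hit hq).1).1 (by omega)
      rw [pv hq] at this
      omega
    exact ⟨q, q1, q2, hq, by omega, live_between hd s4 r4 q1 q2.le, s, q1, s2, s3, s4⟩
  have h1 : ∑ x ∈ F, wt (d.k x.2) = ∑ j ∈ Finset.range N,
      d.w j * ((F.filter (fun x => x.2 = j)).card : ℝ) := by
    rw [← Finset.sum_fiberwise_of_maps_to (t := Finset.range N) (g := Prod.snd)
      (fun x hx => Finset.mem_range.2 ((hF x hx).2.1.trans_le (hN x hx)))]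
    refine Finset.sum_congr rfl (fun j _ => ?_)
    rw [Finset.sum_congr rfl (g := fun _ => d.w j), Finset.sum_const, nsmul_eq_mul, mul_comm]
    intro x hx
    obtain ⟨a1, rfl⟩ := Finset.mem_filter.1 hx
    exact (w_of (hF x a1).2.2.1).symm
  have h2 : ∑ j ∈ Finset.range N, d.w j * ((F.filter (fun x => x.2 = j)).card : ℝ) ≤
      ∑ j ∈ Finset.range N, (d.w j + ∑ s ∈ Finset.range N, if QQ d p s j then d.w j else 0) := by
    refine Finset.sum_le_sum (fun j _ => ?_)
    rw [← Finset.sum_filter, Finset.sum_const, nsmul_eq_mul]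
    have : ((F.filter (fun x => x.2 = j)).card : ℝ) ≤
      1 + (((Finset.range N).filter (fun s => QQ d p s j)).card : ℝ) := by exact_mod_cast hcard j
    have := mul_le_mul_of_nonneg_left this (w_nonneg (d := d) j)
    linarith
  rw [Finset.sum_add_distrib, Finset.sum_comm] at h2
  have h3 : ∑ s ∈ Finset.range N, ∑ j ∈ Finset.range N, (if QQ d p s j then d.w j else 0) ≤
      ∑ s ∈ (Finset.range N).filter (fun s => IsHit p s), (d.ds p s + 2 * d.w (s - 1)) := by
    rw [Finset.sum_filter]
    refine Finset.sum_le_sum (fun s _ => ?_)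
    split_ifs with hs
    · rw [← Finset.sum_filter]
      exact QQ_sum hd hc hs
    · apply le_of_eq
      refine Finset.sum_eq_zero (fun j _ => ?_)
      rw [if_neg (fun h => hs h.1)]
  rw [Finset.sum_add_distrib, ← Finset.mul_sum] at h3
  have h4 := hit_sum hd hc ((Finset.range N).filter (fun s => IsHit p s))
    (fun s hs => (Finset.mem_filter.1 hs).2)
  have h5 : ∑ s ∈ (Finset.range N).filter (fun s => IsHit p s), d.w (s - 1) ≤ 1 := by
    refine le_trans (le_of_eq ?_) (hd.sum (((Finset.range N).filter (fun s => IsHit p s)).image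
      (fun s => s - 1)))
    rw [Finset.sum_image]
    intro x hx y hy hxy
    have a1 := vv_lt (Finset.mem_filter.1 hx).2
    have a2 := vv_lt (Finset.mem_filter.1 hy).2
    simp only at hxy
    omega
  have h6 := hd.sum (Finset.range N)
  change ∑ x ∈ F, wt (d.k x.2) ≤ 8
  linarith

/-- short requests for the constructed set -/
lemma RS_bound (hd : d.Good) (hc : d.Con p) (S : Finset (ℕ × Str))
    (hS : ∀ q ∈ S, ∃ x : ℕ × ℕ × ℕ, (In p x.2.1 x.1 ∧ d.Z x.2.2 ∧ Reg p x.2.1 (d.m x.2.2)) ∧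
      (d.k x.2.2 + p x.2.1, BS p x.1 (d.m x.2.2)) = q) : ∑ q ∈ S, wt q.1 ≤ 2 := by
  refine request_bound (fun x : ℕ × ℕ × ℕ => In p x.2.1 x.1 ∧ d.Z x.2.2 ∧ Reg p x.2.1 (d.m x.2.2))
    (fun x => (d.k x.2.2 + p x.2.1, BS p x.1 (d.m x.2.2))) 2 ?_ S hS
  intro F hF hinj
  have e1 : ∑ x ∈ F, wt (d.k x.2.2 + p x.2.1) =
      ∑ y ∈ F.image (fun x => (x.2.2, p x.2.1)), d.w y.1 * wt y.2 := by
    rw [Finset.sum_image]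
    · refine Finset.sum_congr rfl (fun x hx => ?_)
      rw [wt_add, w_of (hF x hx).2.1.1]
    · intro x hx y hy hxy
      simp only [Prod.mk.injEq] at hxy
      refine hinj x hx y hy ?_
      obtain ⟨x1, x2, x3⟩ := hF x hx
      obtain ⟨y1, y2, y3⟩ := hF y hy
      rw [Prod.mk.injEq]
      refine ⟨by rw [hxy.1, hxy.2], ?_⟩
      rw [← hxy.1]
      rw [← hxy.1] at y3
      refine map_range_eq_iff.2 (fun z hz => ?_)
      have : In p z x.1 ↔ In p z y.1 := by
        rcases le_total x.1 y.1 with h | h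
        · exact reg_same hc.le hxy.2 x3 y3 x1 y1 h z hz
        · exact (reg_same hc.le hxy.2.symm y3 x3 y1 x1 h z hz).symm
      simp only [this]
  change ∑ x ∈ F, wt (d.k x.2.2 + p x.2.1) ≤ 2
  rw [e1]
  set G := F.image (fun x => (x.2.2, p x.2.1)) with hG
  have h2 : ∑ y ∈ G, d.w y.1 * wt y.2 ≤
      ∑ y ∈ (G.image Prod.fst) ×ˢ (G.image Prod.snd), d.w y.1 * wt y.2 := by
    refine Finset.sum_le_sum_of_subset_of_nonneg Finset.subset_product
      (fun _ _ _ => mul_nonneg (w_nonneg _) (wt_nonneg _))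
  rw [Finset.sum_product] at h2
  simp only [← Finset.mul_sum] at h2
  rw [← Finset.sum_mul] at h2
  have h3 := sum_wt_finset 0 (G.image Prod.snd) (fun _ _ => Nat.zero_le _)
  have h4 := hd.sum (G.image Prod.fst)
  rw [wt_zero] at h3
  have h5 : 0 ≤ ∑ i ∈ G.image Prod.snd, wt i := Finset.sum_nonneg (fun _ _ => wt_nonneg _)
  have h6 : 0 ≤ ∑ i ∈ G.image Prod.fst, d.w i := Finset.sum_nonneg (fun _ _ => w_nonneg _)
  nlinarith
end part6

section part7
open CData
variable {d : CData} {p : ℕ → ℕ}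

/-- the constructed set -/
def BSet (p : ℕ → ℕ) : Set ℕ := {x | ∃ s, x < s ∧ ¬ In p x s}

lemma eventually_lt {P : ℕ → ℕ → Prop} {t : ℕ} (h : ∀ x < t, ∀ᶠ s in atTop, P x s) :
    ∀ᶠ s in atTop, ∀ x < t, P x s :=
  (Filter.eventually_all_finite (Set.finite_Iio t)).2 h

lemma AS_ev (hd : d.Good) {A : Set ℕ} (hA : ∀ i, i ∈ A ↔ ∃ s, d.a s i = true) (t : ℕ) :
    ∀ᶠ s in atTop, d.AS s t = restrSet A t := by
  have : ∀ᶠ s in atTop, ∀ x < t, d.a s x = decide (x ∈ A) := by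
    apply eventually_lt
    intro x _
    by_cases hx : x ∈ A
    · obtain ⟨s, hs⟩ := (hA x).1 hx
      refine eventually_atTop.2 ⟨s, fun r hr => ?_⟩
      rw [hd.am s r x hr hs]; simp [hx]
    · refine Eventually.of_forall (fun s => ?_)
      cases h : d.a s x
      · simp [hx]
      · exact absurd ((hA x).2 ⟨s, h⟩) hx
  filter_upwards [this] with s hs
  exact map_range_eq_iff.2 hs

lemma BS_ev (t : ℕ) : ∀ᶠ s in atTop, BS p s t = restrSet (BSet p) t := by
  have : ∀ᶠ s in atTop, ∀ x < t, decide (¬ In p x s) = decide (x ∈ BSet p) := by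
    apply eventually_lt
    intro x _
    by_cases hx : x ∈ BSet p
    · obtain ⟨s, hs1, hs2⟩ := hx
      have hx' : x ∈ BSet p := ⟨s, hs1, hs2⟩
      refine eventually_atTop.2 ⟨s, fun r hr => ?_⟩
      have : ¬ In p x r := fun h => hs2 (h.mono hs1 hr)
      simp [hx', this]
    · refine eventually_atTop.2 ⟨x + 1, fun s hs => ?_⟩
      have : In p x s := by
        by_contra hc
        exact hx ⟨s, by omega, hc⟩
      simp [hx, this]
  filter_upwards [this] with s hs
  exact map_range_eq_iff.2 hs

/-- what the verification needs about complexity -/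
structure Cplx (d : CData) (p : ℕ → ℕ) (A : Set ℕ) (K : Str → ℕ) (cN cM cS : ℕ) : Prop where
  good : d.Good
  con : d.Con p
  lim : ∀ i, i ∈ A ↔ ∃ s, d.a s i = true
  att : ∀ τ, ∃ j, d.V j = true ∧ d.τ j = τ ∧ d.k j = K τ
  le : ∀ j, d.V j = true → K (d.τ j) ≤ d.k j
  N : ∀ s i, IsHit p s → i < s → d.Item p (vv p s) s i → K (d.AS s (d.m i)) ≤ d.k i + 2 * p s + cN
  M : ∀ s j, ¬ IsHit p s → j < s → d.Live s j → K (BS p s (d.m j)) ≤ d.k j + cM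
  S : ∀ s v i, In p v s → d.Z i → Reg p v (d.m i) → K (BS p s (d.m i)) ≤ d.k i + p v + cS
  nt : ¬ ∃ c, ∀ t, K (restrSet A t) ≤ K (zeroStr t) + c

variable {A : Set ℕ} {K : Str → ℕ} {cN cM cS : ℕ}

lemma hit_cplx (h : Cplx d p A K cN cM cS) (n i : ℕ) (hZ : d.Z i) : ∀ s, IsHit p s → p s = n →
    Reg p (vv p s) (d.m i) → i < s → d.AS s (d.m i) = restrSet A (d.m i) →
    K (restrSet A (d.m i)) ≤ d.k i + 2 * n + cN := by
  intro s
  induction s using Nat.strong_induction_on with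
  | _ s ih =>
    intro hs hp hr hi hA
    by_cases hcov : ∃ j < s, d.V j = true ∧ d.τ j = d.AS s (d.m i) ∧ d.k j ≤ d.k i + 2 * p (vv p s)
    · obtain ⟨j, -, j1, j2, j3⟩ := hcov
      have := h.le j j1
      rw [j2, hA] at this
      rw [pv hs] at j3
      omega
    by_cases hnc : d.NC p i (p (vv p s)) s
    · obtain ⟨r, r1, ⟨v, v1, v2, v3⟩, r2, r3, r4⟩ := hnc
      refine ih r r1 ⟨v, v2⟩ ?_ ?_ r3 (r4.trans hA)
      · rw [r2, pv hs, hp]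
      · rw [vv_eq v2]; exact v3
    · have := h.N s i hs hi ⟨hZ, hr, hcov, hnc⟩
      rw [hA, hp] at this
      exact this

lemma m_zero {i t : ℕ} (hV : d.V i = true) (h : d.τ i = zeroStr t) : d.m i = t ∧ d.Z i := by
  have h1 : d.m i = t := by unfold CData.m; rw [h]; simp [zeroStr]
  exact ⟨h1, hV, by rw [h1]; exact h⟩

lemma ev_ge (h : Cplx d p A K cN cM cS) (n : ℕ) : ∀ᶠ s in atTop, n ≤ p s := by
  induction n with
  | zero => exact Eventually.of_forall (fun s => Nat.zero_le _)
  | succ n ih =>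
    obtain ⟨s0, hs0⟩ := eventually_atTop.1 ih
    by_contra hcon
    have hinf : ∀ N, ∃ s, N ≤ s ∧ p s = n := by
      intro N
      by_contra hc
      push Not at hc
      apply hcon
      refine eventually_atTop.2 ⟨max N s0, fun s hs => ?_⟩
      have := hs0 s ((le_max_right _ _).trans hs)
      have := hc s ((le_max_left _ _).trans hs)
      omega
    apply h.nt
    refine ⟨2 * n + cN + ∑ t ∈ Finset.range s0, K (restrSet A t), fun t => ?_⟩
    by_cases ht : t < s0
    · have := Finset.single_le_sum (f := fun t => K (restrSet A t)) (fun _ _ => Nat.zero_le _)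
        (Finset.mem_range.2 ht)
      omega
    · obtain ⟨i, hV, hi, hk⟩ := h.att (zeroStr t)
      obtain ⟨hm, hZ⟩ := m_zero hV hi
      obtain ⟨s1, hs1⟩ := eventually_atTop.1 (AS_ev h.good h.lim t)
      obtain ⟨r, hr, hpr⟩ := hinf (t + i + s1 + s0 + 1)
      obtain ⟨s, hs, hps⟩ := hinf (r + 1)
      have hhit : IsHit p s := by
        rw [isHit_iff h.con, mlen, if_neg (by omega)]
        have := hs0 (s - 1) (by omega)
        omega
      have hge := (vv_hit hhit).ge (r := r) (by omega) (by omega)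
      have := hit_cplx h n i hZ s hhit hps ?_ (by omega) ?_
      · rw [hm] at this
        omega
      · rw [hm]
        refine ⟨by omega, fun x hx hI => ?_⟩
        have h1 := hI.2 (vv p s) (by omega) hx
        rw [pv hhit, hps] at h1
        by_contra hc
        have := hs0 x (by omega)
        omega
      · rw [hm]; exact hs1 s (by omega)

lemma final_marker (h : Cplx d p A K cN cM cS) (n : ℕ) : ∃ v, p v = n ∧ ∀ s, v < s → In p v s := by
  obtain ⟨s0, hs0⟩ := eventually_atTop.1 (ev_ge h (n + 1))
  have h1 := hs0 s0 le_rfl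
  have h2 := h.con.le s0
  obtain ⟨v, v1, v2⟩ := exists_In h.con.le s0 n (by omega)
  refine ⟨v, v2, fun s hs => ⟨hs, fun x _ hv => ?_⟩⟩
  by_cases hx : x < s0
  · exact v1.2 x hx hv
  · have := hs0 x (by omega)
    omega

lemma inf_accept (h : Cplx d p A K cN cM cS) (N : ℕ) : ∃ s, N ≤ s ∧ ¬ IsHit p s := by
  by_contra hcon
  push Not at hcon
  have h1 : ∀ s, N ≤ s → p s ≤ p N := by
    intro s hs
    induction s, hs using Nat.le_induction with
    | base => exact le_rfl
    | succ s hs ih =>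
      have := (isHit_iff h.con).1 (hcon (s + 1) (by omega))
      rw [mlen_succ] at this
      omega
  obtain ⟨s0, hs0⟩ := eventually_atTop.1 (ev_ge h (p N + 1))
  have := hs0 (s0 + N) (by omega)
  have := h1 (s0 + N) (by omega)
  omega

lemma restr_length (A : Set ℕ) (t : ℕ) : (restrSet A t).length = t := by simp [restrSet]

lemma B_le (h : Cplx d p A K cN cM cS) (t : ℕ) :
    K (restrSet (BSet p) t) ≤ K (restrSet A t) + cM := by
  obtain ⟨j, hV, hj, hk⟩ := h.att (restrSet A t)
  have hm : d.m j = t := by unfold CData.m; rw [hj, restr_length]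
  obtain ⟨s1, hs1⟩ := eventually_atTop.1 ((AS_ev h.good h.lim t).and (BS_ev (p := p) t))
  obtain ⟨s, hs, hacc⟩ := inf_accept h (s1 + j + 1)
  obtain ⟨b1, b2⟩ := hs1 s (by omega)
  have := h.M s j hacc (by omega) ⟨hV, by rw [hm, b1]; exact hj⟩
  rw [hm, b2, hk] at this
  exact this

lemma A_not_le (h : Cplx d p A K cN cM cS) (c : ℕ) :
    ¬ ∀ t, K (restrSet A t) ≤ K (restrSet (BSet p) t) + c := by
  intro hle
  obtain ⟨v, hv, hfin⟩ := final_marker h (c + cS)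
  choose f f1 f2 f3 using fun t => h.att (restrSet A t)
  have hev : ∀ᶠ s in atTop, (c + cS + 1 ≤ p s ∧ v < s ∧ ∀ t < v + 1, (d.AS s t = restrSet A t ∧
      BS p s t = restrSet (BSet p) t ∧ f t < s)) :=
    (ev_ge h _).and ((eventually_gt_atTop v).and (eventually_lt (fun t _ =>
      (AS_ev h.good h.lim t).and ((BS_ev t).and (eventually_gt_atTop (f t))))))
  obtain ⟨s, hs1, hs2, hs3⟩ := hev.exists
  have hnv := h.con.nv v s (hfin s hs2) (by omega)
  have hD : d.DN p v s ≠ 0 := by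
    intro h0
    apply hnv
    left
    rw [h0]; exact Nat.zero_le _
  obtain ⟨i, hi, hne⟩ := Finset.exists_ne_zero_of_sum_ne_zero hD
  have hI : d.Item p v s i := by
    by_contra hc
    simp [hc] at hne
  obtain ⟨hZ, hR, hcov, -⟩ := hI
  obtain ⟨b1, b2, b3⟩ := hs3 (d.m i) (by have := hR.1; omega)
  have h1 := h.S s v i (hfin s hs2) hZ hR
  rw [b2] at h1
  have h2 := hle (d.m i)
  apply hcov
  refine ⟨f (d.m i), b3, f1 _, by rw [b1]; exact f2 _, ?_⟩
  rw [f3]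
  omega

lemma code_ok (h : Cplx d p A K cN cM cS) {H : Set ℕ} (hH : ∀ i, i ∈ H ↔ ∃ s, d.h s i = true)
    (n v : ℕ) (hv : v ∉ BSet p) (hn : n ≤ p v) : n ∈ H ↔ d.h v n = true := by
  constructor
  · intro hnH
    have hfin : ∀ s, v < s → In p v s := by
      intro s hs
      by_contra hc
      exact hv ⟨s, hs, hc⟩
    obtain ⟨x, x1, x2⟩ := exists_In h.con.le (v + 1) n (by rw [mlen_succ]; omega)
    obtain ⟨s1, hs1⟩ := (hH n).1 hnH
    by_contra hc
    set s := v + 1 + s1 with hs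
    have hps : p v < p s := (hfin (s + 1) (by omega)).2 s (by omega) (by omega)
    have hxs : In p x s := by
      refine ⟨by have := x1.1; omega, fun y hy hxy => ?_⟩
      by_cases hyv : y < v + 1
      · exact x1.2 y hyv hxy
      · have := (hfin s (by omega)).2 y hy (by omega)
        omega
    refine h.con.nv x s hxs (by omega) (Or.inr ?_)
    rw [x2]
    refine ⟨h.good.hm s1 s n (by omega) hs1, fun hx => hc ?_⟩
    exact h.good.hm x v n (by have := x1.1; omega) hx
  · intro hh
    exact (hH n).2 ⟨v, hh⟩
end part7

section part8
open CData

/-! ### The construction depends on the past only -/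
section congr
variable {d : CData} {P Q : ℕ → ℕ} {s : ℕ}

lemma In_congr (h : ∀ x < s, P x = Q x) (v : ℕ) {r : ℕ} (hr : r ≤ s) : In P v r ↔ In Q v r := by
  have aux : ∀ {P Q : ℕ → ℕ}, (∀ x < s, P x = Q x) → In P v r → In Q v r := by
    intro P Q h hI
    refine ⟨hI.1, fun x hx hv => ?_⟩
    rw [← h v (hI.1.trans_le hr), ← h x (hx.trans_le hr)]
    exact hI.2 x hx hv
  exact ⟨aux h, aux (fun x hx => (h x hx).symm)⟩

lemma Reg_congr (h : ∀ x < s, P x = Q x) {v : ℕ} (hv : v < s) (t : ℕ) : Reg P v t ↔ Reg Q v t := by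
  unfold Reg
  simp only [In_congr h _ (show v + 1 ≤ s by omega)]

lemma Hit_congr (h : ∀ x < s, P x = Q x) {v r : ℕ} (hr : r < s) : Hit P v r ↔ Hit Q v r := by
  unfold Hit
  rw [In_congr h v hr.le, h r hr]
  constructor
  · rintro ⟨h1, h2⟩
    exact ⟨h1, by rw [← h v (h1.1.trans hr)]; exact h2⟩
  · rintro ⟨h1, h2⟩
    exact ⟨h1, by rw [h v (h1.1.trans hr)]; exact h2⟩

lemma NC_congr (h : ∀ x < s, P x = Q x) (i n : ℕ) : d.NC P i n s ↔ d.NC Q i n s := by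
  have aux : ∀ {P Q : ℕ → ℕ}, (∀ x < s, P x = Q x) → d.NC P i n s → d.NC Q i n s := by
    rintro P Q h ⟨r, r1, ⟨v, v1, v2, v3⟩, r2, r3⟩
    exact ⟨r, r1, ⟨v, v1, (Hit_congr h r1).1 v2, (Reg_congr h (v1.trans r1) _).1 v3⟩,
      by rw [← h r r1]; exact r2, r3⟩
  exact ⟨aux h, aux (fun x hx => (h x hx).symm)⟩

lemma Item_congr (h : ∀ x < s, P x = Q x) {v : ℕ} (hv : v < s) (i : ℕ) :
    d.Item P v s i ↔ d.Item Q v s i := by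
  unfold CData.Item
  rw [Reg_congr h hv, h v hv, NC_congr h]

lemma DN_congr (h : ∀ x < s, P x = Q x) {v : ℕ} (hv : v < s) : d.DN P v s = d.DN Q v s := by
  unfold CData.DN
  refine Finset.sum_congr rfl (fun i _ => ?_)
  simp only [Item_congr h hv]

lemma Viol_congr (h : ∀ x < s, P x = Q x) {v : ℕ} (hv : v < s) : d.Viol P v s ↔ d.Viol Q v s := by
  unfold CData.Viol
  rw [DN_congr h hv, h v hv]

lemma mlen_congr (h : ∀ x < s, P x = Q x) : mlen P s = mlen Q s := by
  unfold mlen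
  split_ifs with h0
  · rfl
  · rw [h _ (by omega)]
end congr

/-- one step of the construction -/
noncomputable def stp (d : CData) (P : ℕ → ℕ) (s : ℕ) : ℕ :=
  (List.range (mlen P s)).findIdx
    (fun n => decide (∃ v < s, In P v s ∧ P v = n ∧ d.Viol P v s))

lemma stp_congr {d : CData} {P Q : ℕ → ℕ} {s : ℕ} (h : ∀ x < s, P x = Q x) :
    stp d P s = stp d Q s := by
  unfold stp
  rw [mlen_congr h]
  congr 1
  funext n
  rw [decide_eq_decide]
  refine exists_congr (fun v => and_congr_right (fun hv => ?_))
  rw [In_congr h v le_rfl, h v hv, Viol_congr h hv]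

/-- the history of the construction -/
noncomputable def hst (d : CData) : ℕ → List ℕ
  | 0 => []
  | s + 1 => hst d s ++ [stp d (fun x => (hst d s).getD x 0) s]

/-- the sequence of actions -/
noncomputable def pp (d : CData) (s : ℕ) : ℕ := (hst d (s + 1)).getD s 0

lemma hst_length (d : CData) (s : ℕ) : (hst d s).length = s := by
  induction s with
  | zero => rfl
  | succ s ih => simp [hst, ih]

lemma hst_getD (d : CData) (s x : ℕ) (hx : x < s) : (hst d s).getD x 0 = pp d x := by
  induction s with
  | zero => omega
  | succ s ih =>
    rcases Nat.lt_succ_iff_lt_or_eq.1 hx with h | h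
    · rw [← ih h]
      change (hst d s ++ _).getD x 0 = _
      rw [List.getD_append _ _ _ _ (by rw [hst_length]; exact h)]
    · subst h; rfl

lemma pp_eq_stp (d : CData) (s : ℕ) : pp d s = stp d (pp d) s := by
  rw [← stp_congr (hst_getD d s)]
  unfold pp
  change (hst d s ++ _).getD s 0 = _
  rw [List.getD_append_right _ _ _ _ (by rw [hst_length])]
  simp [hst_length]

lemma pp_con (d : CData) : d.Con (pp d) := by
  have hle : ∀ s, pp d s ≤ mlen (pp d) s := by
    intro s
    rw [pp_eq_stp]
    have := List.findIdx_le_length (xs := List.range (mlen (pp d) s))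
      (p := fun n => decide (∃ v < s, In (pp d) v s ∧ pp d v = n ∧ d.Viol (pp d) v s))
    rw [List.length_range] at this
    exact this
  refine ⟨hle, ?_, ?_⟩
  · intro v s hI hlt hV
    rw [pp_eq_stp d s] at hlt
    have := List.not_of_lt_findIdx hlt
    simp only [List.getElem_range, decide_eq_true_eq] at this
    simp at this
    exact this v hI.1 hI rfl hV
  · intro s hlt
    have h0 := hlt
    have hps := pp_eq_stp d s
    rw [hps] at hlt
    have := List.findIdx_getElem (xs := List.range (mlen (pp d) s))
      (p := fun n => decide (∃ v < s, In (pp d) v s ∧ pp d v = n ∧ d.Viol (pp d) v s))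
      (w := by rw [List.length_range]; exact hlt)
    simp only [List.getElem_range, decide_eq_true_eq] at this
    obtain ⟨v, v1, v2, v3, v4⟩ := this
    exact ⟨v, ⟨v2, v3.trans hps.symm⟩, v4⟩

/-! ### Computability of the construction -/
section prim2

/-- the data are primitive recursive -/
structure CData.PR (d : CData) : Prop where
  V : Primrec d.V
  k : Primrec d.k
  τ : Primrec d.τ
  a : Primrec₂ d.a
  h : Primrec₂ d.h

variable {α : Type} [Primcodable α] {P : α → ℕ → ℕ} {d : CData}

lemma shP (hP : Primrec₂ P) : Primrec₂ (fun (q : α × ℕ) => P q.1) :=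
  hP.comp (Primrec.fst.comp Primrec.fst) Primrec.snd

lemma pr_In (hP : Primrec₂ P) {v s : α → ℕ} (hv : Primrec v) (hs : Primrec s) :
    PrimrecPred (fun b => In (P b) (v b) (s b)) := by
  have h1 : PrimrecRel (fun (b : α) (x : ℕ) => v b < x → P b (v b) < P b x) :=
    pp_imp (pp_lt (hv.comp Primrec.fst) Primrec.snd)
      (pp_lt (hP.comp Primrec.fst (hv.comp Primrec.fst)) (hP.comp Primrec.fst Primrec.snd))
  exact (pp_lt hv hs).and (pp_forall_lt h1 hs)

lemma pr_Reg (hP : Primrec₂ P) {v t : α → ℕ} (hv : Primrec v) (ht : Primrec t) :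
    PrimrecPred (fun b => Reg (P b) (v b) (t b)) := by
  have h1 : PrimrecRel (fun (b : α) (x : ℕ) => In (P b) x (v b + 1) → x < t b) :=
    pp_imp (pr_In (shP hP) Primrec.snd (Primrec.succ.comp (hv.comp Primrec.fst)))
      (pp_lt Primrec.snd (ht.comp Primrec.fst))
  exact (pp_le ht hv).and (pp_forall_lt h1 hv)

lemma pr_Hit (hP : Primrec₂ P) {v s : α → ℕ} (hv : Primrec v) (hs : Primrec s) :
    PrimrecPred (fun b => Hit (P b) (v b) (s b)) :=
  (pr_In hP hv hs).and (pp_eq (hP.comp Primrec.id hv) (hP.comp Primrec.id hs))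

lemma pr_mlen (hP : Primrec₂ P) {s : α → ℕ} (hs : Primrec s) :
    Primrec (fun b => mlen (P b) (s b)) := by
  unfold mlen
  exact pr_ite (pp_eq hs (Primrec.const 0)) (Primrec.const 0)
    (Primrec.succ.comp (hP.comp Primrec.id (Primrec.nat_sub.comp hs (Primrec.const 1))))

lemma pr_m (hd : d.PR) : Primrec d.m := Primrec.list_length.comp hd.τ

lemma pr_AS (hd : d.PR) {s t : α → ℕ} (hs : Primrec s) (ht : Primrec t) :
    Primrec (fun b => d.AS (s b) (t b)) :=
  Primrec.list_map (g := fun b x => d.a (s b) x) (Primrec.list_range.comp ht)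
    (hd.a.comp (hs.comp Primrec.fst) Primrec.snd)

lemma pr_zero : Primrec zeroStr := by
  have h : Primrec (fun n => (List.range n).map (fun _ => false)) :=
    Primrec.list_map (g := fun _ _ => false) Primrec.list_range (Primrec.const false)
  refine h.of_eq (fun n => ?_)
  simp [zeroStr]

lemma pr_Z (hd : d.PR) : PrimrecPred d.Z :=
  (pp_eq hd.V (Primrec.const true)).and (pp_eq hd.τ (pr_zero.comp (pr_m hd)))

lemma pr_Live (hd : d.PR) {s j : α → ℕ} (hs : Primrec s) (hj : Primrec j) :
    PrimrecPred (fun b => d.Live (s b) (j b)) :=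
  (pp_eq (hd.V.comp hj) (Primrec.const true)).and
    (pp_eq (hd.τ.comp hj) (pr_AS hd hs ((pr_m hd).comp hj)))

lemma pr_NC (hd : d.PR) (hP : Primrec₂ P) {i n s : α → ℕ} (hi : Primrec i) (hn : Primrec n)
    (hs : Primrec s) : PrimrecPred (fun b => d.NC (P b) (i b) (n b) (s b)) := by
  have hmi : Primrec (fun b => d.m (i b)) := (pr_m hd).comp hi
  have h0 : PrimrecRel (fun (q : α × ℕ) (v : ℕ) => Hit (P q.1) v q.2 ∧ Reg (P q.1) v (d.m (i q.1))) :=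
    (pr_Hit (shP (shP hP)) Primrec.snd (Primrec.snd.comp Primrec.fst)).and
      (pr_Reg (shP (shP hP)) Primrec.snd (hmi.comp (Primrec.fst.comp Primrec.fst)))
  have h1 : PrimrecPred (fun (q : α × ℕ) => ∃ v < q.2, Hit (P q.1) v q.2 ∧
      Reg (P q.1) v (d.m (i q.1))) := pp_exists_lt h0 Primrec.snd
  have h2 : PrimrecPred (fun (q : α × ℕ) => P q.1 q.2 = n q.1) :=
    pp_eq hP (hn.comp Primrec.fst)
  have h3 : PrimrecPred (fun (q : α × ℕ) => i q.1 < q.2) :=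
    pp_lt (hi.comp Primrec.fst) Primrec.snd
  have h4 : PrimrecPred (fun (q : α × ℕ) => d.AS q.2 (d.m (i q.1)) = d.AS (s q.1) (d.m (i q.1))) :=
    pp_eq (pr_AS hd Primrec.snd (hmi.comp Primrec.fst))
      (pr_AS hd (hs.comp Primrec.fst) (hmi.comp Primrec.fst))
  have h5 : PrimrecRel (fun (b : α) (r : ℕ) => (∃ v < r, Hit (P b) v r ∧ Reg (P b) v (d.m (i b))) ∧
      P b r = n b ∧ i b < r ∧ d.AS r (d.m (i b)) = d.AS (s b) (d.m (i b))) :=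
    h1.and (h2.and (h3.and h4))
  exact pp_exists_lt h5 hs

lemma pr_Item (hd : d.PR) (hP : Primrec₂ P) {v s i : α → ℕ} (hv : Primrec v)
    (hs : Primrec s) (hi : Primrec i) : PrimrecPred (fun b => d.Item (P b) (v b) (s b) (i b)) := by
  have hmi : Primrec (fun b => d.m (i b)) := (pr_m hd).comp hi
  have hpv : Primrec (fun b => P b (v b)) := hP.comp Primrec.id hv
  have hki : Primrec (fun b => d.k (i b)) := hd.k.comp hi
  have hAS := pr_AS hd hs hmi
  have hb : Primrec (fun b => d.k (i b) + 2 * P b (v b)) :=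
    Primrec.nat_add.comp hki (Primrec.nat_mul.comp (Primrec.const 2) hpv)
  have h1 : PrimrecRel (fun (b : α) (j : ℕ) => d.V j = true ∧ d.τ j = d.AS (s b) (d.m (i b)) ∧
      d.k j ≤ d.k (i b) + 2 * P b (v b)) :=
    (pp_eq (hd.V.comp Primrec.snd) (Primrec.const true)).and
      ((pp_eq (hd.τ.comp Primrec.snd) (hAS.comp Primrec.fst)).and
        (pp_le (hd.k.comp Primrec.snd) (hb.comp Primrec.fst)))
  have h2 := (pp_exists_lt h1 hs).not
  exact ((pr_Z hd).comp hi).and ((pr_Reg hP hv hmi).and (h2.and (pr_NC hd hP hi hpv hs).not))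

lemma pr_DN (hd : d.PR) (hP : Primrec₂ P) {v s : α → ℕ} (hv : Primrec v)
    (hs : Primrec s) : Primrec (fun b => d.DN (P b) (v b) (s b)) := by
  have h1 : Primrec (fun (q : α × ℕ) => 2 ^ (s q.1 - d.k q.2)) :=
    primrec_pow.comp (Primrec.const 2) (Primrec.nat_sub.comp (hs.comp Primrec.fst)
      (hd.k.comp Primrec.snd))
  have h2 : PrimrecPred (fun (q : α × ℕ) => d.Item (P q.1) (v q.1) (s q.1) q.2) :=
    pr_Item hd (shP hP) (hv.comp Primrec.fst) (hs.comp Primrec.fst) Primrec.snd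
  have h3 : Primrec₂ (fun (b : α) (i : ℕ) =>
      if d.Item (P b) (v b) (s b) i then 2 ^ (s b - d.k i) else 0) :=
    pr_ite h2 h1 (Primrec.const 0)
  exact primrec_sum h3 hs

lemma pr_LN (hd : d.PR) {v s : α → ℕ} (hv : Primrec v)
    (hs : Primrec s) : Primrec (fun b => d.LN (v b) (s b)) := by
  have h1 : Primrec (fun (q : α × ℕ) => 2 ^ (s q.1 - d.k q.2)) :=
    primrec_pow.comp (Primrec.const 2) (Primrec.nat_sub.comp (hs.comp Primrec.fst)
      (hd.k.comp Primrec.snd))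
  have h2 : PrimrecPred (fun (q : α × ℕ) => d.Live (s q.1) q.2 ∧ v q.1 < d.m q.2) :=
    (pr_Live hd (hs.comp Primrec.fst) Primrec.snd).and
      (pp_lt (hv.comp Primrec.fst) ((pr_m hd).comp Primrec.snd))
  have h3 : Primrec₂ (fun (b : α) (i : ℕ) =>
      if d.Live (s b) i ∧ v b < d.m i then 2 ^ (s b - d.k i) else 0) :=
    pr_ite h2 h1 (Primrec.const 0)
  exact primrec_sum h3 hs

lemma pr_Viol (hd : d.PR) (hP : Primrec₂ P) {v s : α → ℕ} (hv : Primrec v)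
    (hs : Primrec s) : PrimrecPred (fun b => d.Viol (P b) (v b) (s b)) := by
  have hpv : Primrec (fun b => P b (v b)) := hP.comp Primrec.id hv
  have h1 : Primrec (fun b => 4 ^ (P b (v b)) * d.LN (v b) (s b)) :=
    Primrec.nat_mul.comp (primrec_pow.comp (Primrec.const 4) hpv) (pr_LN hd hv hs)
  have h2 : PrimrecPred (fun b => d.h (s b) (P b (v b)) = true) :=
    pp_eq (hd.h.comp hs hpv) (Primrec.const true)
  have h3 : PrimrecPred (fun b => d.h (v b) (P b (v b)) = true) :=
    pp_eq (hd.h.comp hv hpv) (Primrec.const true)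
  exact (pp_le (pr_DN hd hP hv hs) h1).or (h2.and h3.not)

lemma pr_stp (hd : d.PR) (hP : Primrec₂ P) {s : α → ℕ} (hs : Primrec s) :
    Primrec (fun b => stp d (P b) (s b)) := by
  have h1 : PrimrecRel (fun (q : α × ℕ) (v : ℕ) => In (P q.1) v (s q.1) ∧ P q.1 v = q.2 ∧
      d.Viol (P q.1) v (s q.1)) := by
    have hs' : Primrec (fun (q : (α × ℕ) × ℕ) => s q.1.1) :=
      hs.comp (Primrec.fst.comp Primrec.fst)
    have hP' := shP (shP hP)
    exact (pr_In hP' Primrec.snd hs').and ((pp_eq (hP'.comp Primrec.id Primrec.snd)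
      (Primrec.snd.comp Primrec.fst)).and (pr_Viol hd hP' Primrec.snd hs'))
  have h2 : PrimrecPred (fun (q : α × ℕ) => ∃ v < s q.1, In (P q.1) v (s q.1) ∧ P q.1 v = q.2 ∧
      d.Viol (P q.1) v (s q.1)) := pp_exists_lt h1 (hs.comp Primrec.fst)
  have h3 : Primrec₂ (fun (b : α) (n : ℕ) => decide (∃ v < s b, In (P b) v (s b) ∧ P b v = n ∧
      d.Viol (P b) v (s b))) := by
    obtain ⟨inst, h⟩ := h2
    refine Primrec.of_eq h (fun q => ?_)
    simp only [decide_eq_decide]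
  exact Primrec.list_findIdx (Primrec.list_range.comp (pr_mlen hP hs)) h3

lemma pr_pp (hd : d.PR) : Primrec (pp d) := by
  have h0 : Primrec₂ (fun (l : List ℕ) (x : ℕ) => l.getD x 0) := Primrec.list_getD 0
  have h1 : Primrec (fun q : ℕ × List ℕ => stp d (fun x => q.2.getD x 0) q.1) :=
    pr_stp hd (P := fun (q : ℕ × List ℕ) x => q.2.getD x 0)
      (h0.comp (Primrec.snd.comp Primrec.fst) Primrec.snd) Primrec.fst
  have h2 : Primrec (hst d) := by
    have h3 : Primrec₂ (fun (_ : ℕ) (q : ℕ × List ℕ) =>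
        q.2 ++ [stp d (fun x => q.2.getD x 0) q.1]) :=
      Primrec.list_concat.comp (Primrec.snd.comp Primrec.snd) (h1.comp Primrec.snd)
    have h4 := Primrec.nat_rec' (h := fun (_ : ℕ) (q : ℕ × List ℕ) =>
        q.2 ++ [stp d (fun x => q.2.getD x 0) q.1]) (f := fun s : ℕ => s) (g := fun _ => [])
        Primrec.id (Primrec.const []) h3
    refine h4.of_eq (fun s => ?_)
    induction s with
    | zero => rfl
    | succ s ih =>
      change _ ++ [_] = hst d s ++ [_]
      rw [← ih]
  exact h0.comp (h2.comp Primrec.succ) Primrec.id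

end prim2

/-- a form of the machine existence theorem -/
lemma kc_pred {U : Str →. Str} (hU : OptimalPF U) {ι : Type} [Primcodable ι] (R : ι → Prop)
    (hR : PrimrecPred R) (g : ι → ℕ × Str) (hg : Primrec g) (C : ℕ)
    (hw : ∀ S : Finset (ℕ × Str), (∀ q ∈ S, ∃ x, R x ∧ g x = q) → ∑ q ∈ S, wt q.1 ≤ 2 ^ C) :
    ∃ c : ℕ, ∀ x, R x → KC U (g x).2 ≤ (((g x).1 + c : ℕ) : ℕ∞) := by
  let f : ℕ → Option (ℕ × Str) := fun s => (Encodable.decode (α := ι) s).bind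
    (fun x => if R x then Option.some (g x) else Option.none)
  have h1 : Primrec (fun x : ι => if R x then Option.some (g x) else Option.none) :=
    pr_ite hR (Primrec.option_some.comp hg) (Primrec.const Option.none)
  have hf : Primrec f :=
    Primrec.option_bind (g := fun _ x => if R x then Option.some (g x) else Option.none)
      Primrec.decode (h1.comp Primrec.snd)
  obtain ⟨c, hc⟩ := kc_lemma hU f hf C (by
    intro S hS
    apply hw
    intro q hq
    obtain ⟨s, hs⟩ := hS q hq
    simp only [f, Option.bind_eq_some_iff] at hs
    obtain ⟨x, -, hx⟩ := hs
    by_cases hRx : R x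
    · rw [if_pos hRx] at hx
      exact ⟨x, hRx, Option.some.inj hx⟩
    · rw [if_neg hRx] at hx
      cases hx)
  refine ⟨c, fun x hx => hc (Encodable.encode x) _ _ ?_⟩
  simp only [f, Encodable.encodek, Option.bind_some, if_pos hx]
end part8

section part9
open CData

/-- a set with a primitive recursive enumeration is computably enumerable -/
lemma ce_of_exists {B : Set ℕ} {R : ℕ → ℕ → Prop} (hR : PrimrecRel R)
    (hB : ∀ x, x ∈ B ↔ ∃ s, R x s) : CESet B := by
  have h1 : Primrec₂ (fun x s => decide (R x s)) := by
    obtain ⟨inst, h⟩ := hR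
    refine Primrec.of_eq h (fun q => ?_)
    simp only [decide_eq_decide]
  have h2 : Partrec₂ (fun x s => (Part.some (decide (R x s)) : Part Bool)) := h1.to_comp.partrec₂
  have h3 := Partrec.rfind h2
  refine ⟨_, Partrec.nat_iff.1 h3, fun n => ?_⟩
  rw [hB]
  refine Iff.trans ?_ (Nat.rfind_dom (p := fun s => Part.some (decide (R n s)))).symm
  constructor
  · rintro ⟨s, hs⟩
    exact ⟨s, by simp [hs], fun _ => trivial⟩
  · rintro ⟨s, hs, -⟩
    exact ⟨s, by simpa using hs⟩

/-- the data of an enumeration -/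
noncomputable def mkData (e : ℕ → Option (ℕ × Str)) (a h : ℕ → ℕ → Bool) : CData where
  V j := (e j).isSome
  k j := ((e j).map Prod.fst).getD 0
  τ j := ((e j).map Prod.snd).getD []
  a := a
  h := h

lemma mk_iff (e : ℕ → Option (ℕ × Str)) (a h : ℕ → ℕ → Bool) (j k : ℕ) (τ : Str) :
    e j = Option.some (k, τ) ↔
      ((mkData e a h).V j = true ∧ (mkData e a h).k j = k ∧ (mkData e a h).τ j = τ) := by
  unfold mkData
  rcases hj : e j with _ | ⟨k', τ'⟩ <;> simp [hj]

lemma mk_PR {e : ℕ → Option (ℕ × Str)} {a h : ℕ → ℕ → Bool} (he : Primrec e)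
    (ha : Primrec₂ a) (hh : Primrec₂ h) : (mkData e a h).PR := by
  refine ⟨Primrec.option_isSome.comp he, ?_, ?_, ha, hh⟩
  · exact Primrec.option_getD.comp (Primrec.option_map (g := fun _ q => Prod.fst q) he
      (Primrec.fst.comp Primrec.snd)) (Primrec.const 0)
  · exact Primrec.option_getD.comp (Primrec.option_map (g := fun _ q => Prod.snd q) he
      (Primrec.snd.comp Primrec.snd)) (Primrec.const [])

section requests
variable {d : CData} {U : Str →. Str}

lemma ex_N (hU : OptimalPF U) (hd : d.PR) (hg : d.Good) : ∃ c : ℕ, ∀ s i, IsHit (pp d) s → i < s →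
    d.Item (pp d) (vv (pp d) s) s i →
    KC U (d.AS s (d.m i)) ≤ ((d.k i + 2 * pp d s + c : ℕ) : ℕ∞) := by
  have hp := pr_pp hd
  have hP : Primrec₂ (fun (_ : ℕ × ℕ × ℕ) => pp d) := hp.comp Primrec.snd
  have p1 : Primrec (fun x : ℕ × ℕ × ℕ => x.1) := Primrec.fst
  have p2 : Primrec (fun x : ℕ × ℕ × ℕ => x.2.1) := Primrec.fst.comp Primrec.snd
  have p3 : Primrec (fun x : ℕ × ℕ × ℕ => x.2.2) := Primrec.snd.comp Primrec.snd
  obtain ⟨c, hc⟩ := kc_pred hU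
    (fun x : ℕ × ℕ × ℕ => Hit (pp d) x.2.1 x.1 ∧ x.2.2 < x.1 ∧ d.Item (pp d) x.2.1 x.1 x.2.2)
    ((pr_Hit hP p2 p1).and ((pp_lt p3 p1).and (pr_Item hd hP p2 p1 p3)))
    (fun x => (d.k x.2.2 + 2 * pp d x.1, d.AS x.1 (d.m x.2.2)))
    (Primrec.pair (Primrec.nat_add.comp (hd.k.comp p3)
      (Primrec.nat_mul.comp (Primrec.const 2) (hp.comp p1))) (pr_AS hd p1 ((pr_m hd).comp p3))) 3 (by
      intro S hS
      refine (RN_bound hg (pp_con d) S ?_).trans (by norm_num)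
      intro q hq
      obtain ⟨x, ⟨h1, h2, h3⟩, h4⟩ := hS q hq
      refine ⟨(x.1, x.2.2), ⟨⟨_, h1⟩, h2, ?_⟩, h4⟩
      rw [vv_eq h1]; exact h3)
  exact ⟨c, fun s i hs hi hI => hc (s, vv (pp d) s, i) ⟨vv_hit hs, hi, hI⟩⟩

lemma pr_BS {α : Type} [Primcodable α] {P : ℕ → ℕ} (hP : Primrec P) {s t : α → ℕ}
    (hs : Primrec s) (ht : Primrec t) : Primrec (fun b => BS P (s b) (t b)) := by
  have h1 : PrimrecPred (fun q : α × ℕ => ¬ In P q.2 (s q.1)) :=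
    (pr_In (P := fun (_ : α × ℕ) => P) (hP.comp Primrec.snd) Primrec.snd (hs.comp Primrec.fst)).not
  have h2 : Primrec₂ (fun (b : α) (x : ℕ) => decide (¬ In P x (s b))) := by
    obtain ⟨inst, h⟩ := h1
    refine Primrec.of_eq h (fun q => ?_)
    simp only [decide_eq_decide]
  exact Primrec.list_map (Primrec.list_range.comp ht) h2

lemma ex_M (hU : OptimalPF U) (hd : d.PR) (hg : d.Good) : ∃ c : ℕ, ∀ s j, ¬ IsHit (pp d) s → j < s →
    d.Live s j → KC U (BS (pp d) s (d.m j)) ≤ ((d.k j + c : ℕ) : ℕ∞) := by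
  have hp := pr_pp hd
  have p1 : Primrec (fun x : ℕ × ℕ => x.1) := Primrec.fst
  have p2 : Primrec (fun x : ℕ × ℕ => x.2) := Primrec.snd
  have h0 : PrimrecRel (fun (x : ℕ × ℕ) (v : ℕ) => Hit (pp d) v x.1) :=
    pr_Hit (P := fun (_ : (ℕ × ℕ) × ℕ) => pp d) (hp.comp Primrec.snd) Primrec.snd
      (p1.comp Primrec.fst)
  have h1 : PrimrecPred (fun x : ℕ × ℕ => ¬ IsHit (pp d) x.1) := by
    refine (pp_exists_lt h0 p1).not.of_eq (fun x => ?_)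
    apply not_congr
    exact ⟨fun ⟨v, _, hv⟩ => ⟨v, hv⟩, fun ⟨v, hv⟩ => ⟨v, hv.1.1, hv⟩⟩
  obtain ⟨c, hc⟩ := kc_pred hU
    (fun x : ℕ × ℕ => ¬ IsHit (pp d) x.1 ∧ x.2 < x.1 ∧ d.Live x.1 x.2)
    (h1.and ((pp_lt p2 p1).and (pr_Live hd p1 p2)))
    (fun x => (d.k x.2, BS (pp d) x.1 (d.m x.2)))
    (Primrec.pair (hd.k.comp p2) (pr_BS hp p1 ((pr_m hd).comp p2))) 3 (by
      intro S hS
      exact (RM_bound hg (pp_con d) S hS).trans (by norm_num))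
  exact ⟨c, fun s j hs hj hI => hc (s, j) ⟨hs, hj, hI⟩⟩

lemma ex_S (hU : OptimalPF U) (hd : d.PR) (hg : d.Good) : ∃ c : ℕ, ∀ s v i, In (pp d) v s → d.Z i →
    Reg (pp d) v (d.m i) → KC U (BS (pp d) s (d.m i)) ≤ ((d.k i + pp d v + c : ℕ) : ℕ∞) := by
  have hp := pr_pp hd
  have hP : Primrec₂ (fun (_ : ℕ × ℕ × ℕ) => pp d) := hp.comp Primrec.snd
  have p1 : Primrec (fun x : ℕ × ℕ × ℕ => x.1) := Primrec.fst
  have p2 : Primrec (fun x : ℕ × ℕ × ℕ => x.2.1) := Primrec.fst.comp Primrec.snd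
  have p3 : Primrec (fun x : ℕ × ℕ × ℕ => x.2.2) := Primrec.snd.comp Primrec.snd
  have hm3 := (pr_m hd).comp p3
  obtain ⟨c, hc⟩ := kc_pred hU
    (fun x : ℕ × ℕ × ℕ => In (pp d) x.2.1 x.1 ∧ d.Z x.2.2 ∧ Reg (pp d) x.2.1 (d.m x.2.2))
    ((pr_In hP p2 p1).and (((pr_Z hd).comp p3).and (pr_Reg hP p2 hm3)))
    (fun x => (d.k x.2.2 + pp d x.2.1, BS (pp d) x.1 (d.m x.2.2)))
    (Primrec.pair (Primrec.nat_add.comp (hd.k.comp p3) (hp.comp p2)) (pr_BS hp p1 hm3)) 1 (by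
      intro S hS
      exact (RS_bound hg (pp_con d) S hS).trans (by norm_num))
  exact ⟨c, fun s v i hs hj hI => hc (s, v, i) ⟨hs, hj, hI⟩⟩
end requests

end part9

/-- Let `A` be a computably enumerable set which is not `K`-trivial.
Then there exists a computably enumerable set `B` such that `B ≡_T ∅'` and `B <_K A`. -/
theorem stmt0 (U : Str →. Str) (hU : OptimalPF U)
    (A : Set ℕ) (hA : CESet A) (hAnt : ¬ KTrivialSet U A) :
    ∃ B : Set ℕ, CESet B ∧ TuringEquivSet B haltingSet ∧ KLtSet U B A := by
  obtain ⟨e, he, hb, hinj, hchar⟩ := U_enum hU.1.1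
  obtain ⟨a, ha, ham, haA⟩ := ce_approx hA
  obtain ⟨h, hh, hhm, hhH⟩ := halting_approx
  obtain ⟨d, hdd⟩ : ∃ d, d = mkData e a h := ⟨_, rfl⟩
  have hPR : d.PR := hdd ▸ mk_PR he ha hh
  have hiff : ∀ j k τ, e j = Option.some (k, τ) ↔ (d.V j = true ∧ d.k j = k ∧ d.τ j = τ) :=
    fun j k τ => hdd ▸ mk_iff e a h j k τ
  have hda : d.a = a := by rw [hdd]; rfl
  have hdh : d.h = h := by rw [hdd]; rfl
  have hge : ∀ j, d.V j = true → e j = Option.some (d.k j, d.τ j) :=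
    fun j hj => (hiff j _ _).2 ⟨hj, rfl, rfl⟩
  have hw : ∀ j, d.w j = ewt (e j) := by
    intro j
    unfold CData.w
    split_ifs with hj
    · rw [hge j hj, ewt_some]
    · rcases hj' : e j with _ | ⟨k, τ⟩
      · rw [ewt_none]
      · exact absurd ((hiff j k τ).1 hj').1 hj
  have hgood : d.Good := by
    refine ⟨fun j hj => (hb j _ _ (hge j hj)).1, fun j hj => (hb j _ _ (hge j hj)).2, ?_, ?_, ?_, ?_⟩
    · intro i j hi hj hk hτ
      refine hinj i j (d.k j, d.τ j) ?_ (hge j hj)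
      rw [hge i hi, hk, hτ]
    · intro J
      simp only [hw]
      refine sum_enum_le e hinj 1 (fun S hS => ?_) J
      apply kraft_machine hU.1
      intro q hq
      exact (hchar q.1 q.2).1 (hS q hq)
    · rw [hda]; exact ham
    · rw [hdh]; exact hhm
  obtain ⟨cN, hN⟩ := ex_N hU hPR hgood
  obtain ⟨cM, hM⟩ := ex_M hU hPR hgood
  obtain ⟨cS, hS⟩ := ex_S hU hPR hgood
  obtain ⟨K, hKdef⟩ : ∃ K : Str → ℕ, ∀ τ, KC U τ = (K τ : ℕ∞) :=
    ⟨fun τ => (KC U τ).toNat, fun τ => (ENat.natCast_toNat (KC_ne_top hU τ)).symm⟩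
  have hC : Cplx d (pp d) A K cN cM cS := by
    refine ⟨hgood, pp_con d, ?_, ?_, ?_, ?_, ?_, ?_, ?_⟩
    · rw [hda]; exact haA
    · intro τ
      obtain ⟨σ, h1, h2⟩ := KC_attained (KC_ne_top hU τ)
      obtain ⟨j, hj⟩ := (hchar σ.length τ).2 ⟨σ, rfl, h1⟩
      obtain ⟨j1, j2, j3⟩ := (hiff j _ _).1 hj
      refine ⟨j, j1, j3, ?_⟩
      rw [hKdef] at h2
      rw [j2]
      exact_mod_cast h2.symm
    · intro j hj
      obtain ⟨σ, h1, h2⟩ := (hchar _ _).1 ⟨j, hge j hj⟩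
      have := KC_le h2
      rw [hKdef, h1] at this
      exact_mod_cast this
    · intro s i h1 h2 h3
      have := hN s i h1 h2 h3
      rw [hKdef] at this
      exact_mod_cast this
    · intro s j h1 h2 h3
      have := hM s j h1 h2 h3
      rw [hKdef] at this
      exact_mod_cast this
    · intro s v i h1 h2 h3
      have := hS s v i h1 h2 h3
      rw [hKdef] at this
      exact_mod_cast this
    · rintro ⟨c, hc⟩
      apply hAnt
      refine ⟨c, fun t => ?_⟩
      rw [hKdef, hKdef]
      exact_mod_cast hc t
  have hBce : CESet (BSet (pp d)) := by
    refine ce_of_exists (R := fun x s => x < s ∧ ¬ In (pp d) x s) ?_ (fun x => Iff.rfl)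
    exact (pp_lt Primrec.fst Primrec.snd).and
      (pr_In (P := fun (_ : ℕ × ℕ) => pp d) ((pr_pp hPR).comp Primrec.snd)
        Primrec.fst Primrec.snd).not
  refine ⟨BSet (pp d), hBce, ⟨ce_le_halting hBce, ?_⟩, ?_, ?_⟩
  · have hq : Primrec₂ (fun n v => decide (n ≤ pp d v)) := by
      have h1 : PrimrecPred (fun q : ℕ × ℕ => q.1 ≤ pp d q.2) :=
        pp_le Primrec.fst ((pr_pp hPR).comp Primrec.snd)
      obtain ⟨inst, h⟩ := h1
      refine Primrec.of_eq h (fun q => ?_)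
      simp only [decide_eq_decide]
    refine search_le (fun n v => decide (n ≤ pp d v)) hq (fun n v => d.h v n)
      (hPR.h.comp Primrec.snd Primrec.fst) ?_ ?_
    · intro n
      obtain ⟨v, v1, v2⟩ := final_marker hC n
      refine ⟨v, ?_, by simp [v1]⟩
      rintro ⟨s, s1, s2⟩
      exact s2 (v2 s s1)
    · intro n v hv hn
      refine code_ok hC (by rw [hdh]; exact hhH) n v hv (by simpa using hn)
  · refine ⟨cM, fun t => ?_⟩
    rw [hKdef, hKdef]
    exact_mod_cast B_le hC t
  · rintro ⟨c, hc⟩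
    refine A_not_le hC c (fun t => ?_)
    have := hc t
    rw [hKdef, hKdef] at this
    exact_mod_cast this

end KPaper
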